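/- arXiv:quant-ph/0108043 — 4 statements merged into one kernel-verified Lean document; each statement's English description precedes it below -/
import Mathlib

section
/- (Lorentz singular value decomposition) For every two-qubit density matrix ρ there exist proper orthochronous Lorentz matrices L1, L2 and a real 4×4 matrix Σ such that R_ρ = L1 · Σ · L2ᵀ, where Σ is either (i) diagonal, Σ = diag(s0,s1,s2,s3) with s0 ≥ s1 ≥ s2 ≥ |s3|, or (ii) of the form Σ₀₀ = a, Σ₀₃ = b, Σ₁₁ = Σ₂₂ = d, Σ₃₀ = c, Σ₃₃ = b+c−a, with all other entries zero, where (a,b,c,d) satisfies one of the four conditions: (b = c = a/2); (d = 0 and c = 0 and b = a); (d = 0 and b = 0 and c = a); (d = 0 and a = b = c). -/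
open Matrix Kronecker ComplexOrder

noncomputable section

/-- The Pauli matrices σ₀ = I, σ₁, σ₂, σ₃. -/
def pauli : Fin 4 → Matrix (Fin 2) (Fin 2) ℂ :=
  ![1, !![0, 1; 1, 0], !![0, -Complex.I; Complex.I, 0], !![1, 0; 0, -1]]

/-- The Minkowski metric η = diag(1,-1,-1,-1). -/
def η : Matrix (Fin 4) (Fin 4) ℝ := Matrix.diagonal ![1, -1, -1, -1]

/-- A proper orthochronous Lorentz matrix. -/
def LorentzPO (L : Matrix (Fin 4) (Fin 4) ℝ) : Prop :=
  Lᵀ * η * L = η ∧ L.det = 1 ∧ 1 ≤ L 0 0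

/-- The R-matrix of a 4×4 complex matrix: R_{ij} = Tr(ρ (σ_i ⊗ σ_j)). -/
def Rmat (ρ : Matrix (Fin 2 × Fin 2) (Fin 2 × Fin 2) ℂ) : Matrix (Fin 4) (Fin 4) ℝ :=
  Matrix.of fun i j => ((ρ * (pauli i ⊗ₖ pauli j)).trace).re

abbrev M2 := Matrix (Fin 2) (Fin 2) ℂ
abbrev M4 := Matrix (Fin 2 × Fin 2) (Fin 2 × Fin 2) ℂ

def Lam (A : M2) : Matrix (Fin 4) (Fin 4) ℝ :=
  Matrix.of fun i k => ((Aᴴ * pauli i * A * pauli k).trace).re / 2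

def act (A B : M2) (ρ : M4) : M4 := (A ⊗ₖ B) * ρ * (A ⊗ₖ B)ᴴ

lemma pauli_expand (X : M2) (hX : X.IsHermitian) :
    X = ∑ k, (((X * pauli k).trace.re / 2 : ℝ) : ℂ) • pauli k := by
  have h00 := congrArg Complex.im (hX.apply 0 0)
  have h11 := congrArg Complex.im (hX.apply 1 1)
  have h01r := congrArg Complex.re (hX.apply 0 1)
  have h01i := congrArg Complex.im (hX.apply 0 1)
  simp at h00 h11 h01r h01i
  ext i j
  fin_cases i <;> fin_cases j <;> apply Complex.ext <;>
    simp [Fin.sum_univ_four, pauli, Matrix.trace, Matrix.mul_apply, Matrix.sum_apply] <;> linarith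

lemma pauli_herm (i : Fin 4) : (pauli i).IsHermitian := by
  fin_cases i <;> ext a b <;> fin_cases a <;> fin_cases b <;> simp [pauli]

lemma conj_pauli (A : M2) (i : Fin 4) :
    Aᴴ * pauli i * A = ∑ k, ((Lam A i k : ℝ) : ℂ) • pauli k := by
  exact pauli_expand _ (by
    have := Matrix.isHermitian_conjTranspose_mul_mul A (pauli_herm i)
    exact this)

lemma Rmat_act (A B : M2) (ρ : M4) :
    Rmat (act A B ρ) = Lam A * Rmat ρ * (Lam B)ᵀ := by
  ext i j
  have h1 : (act A B ρ * (pauli i ⊗ₖ pauli j)).trace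
      = (ρ * ((Aᴴ * pauli i * A) ⊗ₖ (Bᴴ * pauli j * B))).trace := by
    unfold act
    rw [Matrix.mul_kronecker_mul, Matrix.mul_kronecker_mul, ← Matrix.conjTranspose_kronecker]
    rw [Matrix.mul_assoc, Matrix.mul_assoc, Matrix.trace_mul_comm]
    simp only [Matrix.mul_assoc]
  have h2 : (Aᴴ * pauli i * A) ⊗ₖ (Bᴴ * pauli j * B)
      = ∑ k, ∑ l, ((Lam A i k * Lam B j l : ℝ) : ℂ) • (pauli k ⊗ₖ pauli l) := by
    rw [conj_pauli, conj_pauli]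
    ext ⟨a, b⟩ ⟨c, d⟩
    simp only [Matrix.kroneckerMap_apply, Matrix.sum_apply, Matrix.smul_apply, smul_eq_mul,
      Finset.sum_mul_sum]
    refine Finset.sum_congr rfl fun k _ => Finset.sum_congr rfl fun l _ => ?_
    push_cast; ring
  have h3 : Rmat (act A B ρ) i j = ∑ k, ∑ l, Lam A i k * Lam B j l * Rmat ρ k l := by
    simp only [Rmat, Matrix.of_apply]
    rw [h1, h2]
    simp only [Finset.mul_sum, Matrix.trace_sum, Complex.re_sum, Matrix.mul_smul, Matrix.trace_smul,
      smul_eq_mul, Complex.re_ofReal_mul]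
  rw [h3, Matrix.mul_apply]
  simp only [Matrix.mul_apply, Matrix.transpose_apply, Finset.sum_mul]
  rw [Finset.sum_comm]
  refine Finset.sum_congr rfl fun k _ => Finset.sum_congr rfl fun l _ => ?_
  ring

lemma act_act (A B C D : M2) (ρ : M4) : act A B (act C D ρ) = act (A * C) (B * D) ρ := by
  unfold act
  rw [Matrix.mul_kronecker_mul, Matrix.conjTranspose_mul]
  simp only [Matrix.mul_assoc]

lemma act_one (ρ : M4) : act 1 1 ρ = ρ := by simp [act]

lemma act_psd (A B : M2) {ρ : M4} (h : ρ.PosSemidef) : (act A B ρ).PosSemidef :=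
  h.mul_mul_conjTranspose_same _

/-- Real form of a Lorentz matrix attached to a spinor matrix with entries `a b c d`. -/
def LamE (ar ai br bi cr ci dr di : ℝ) : Matrix (Fin 4) (Fin 4) ℝ :=
  !![(ar^2+ai^2+cr^2+ci^2+br^2+bi^2+dr^2+di^2)/2, ar*br+ai*bi+cr*dr+ci*di,
      -(ar*bi-ai*br+cr*di-ci*dr), (ar^2+ai^2+cr^2+ci^2-br^2-bi^2-dr^2-di^2)/2;
    ar*cr+ai*ci+br*dr+bi*di, ar*dr+ai*di+cr*br+ci*bi,
      -(ar*di-ai*dr+cr*bi-ci*br), ar*cr+ai*ci-(br*dr+bi*di);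
    ar*ci-ai*cr+(br*di-bi*dr), (ar*di-ai*dr)-(cr*bi-ci*br),
      (ar*dr+ai*di)-(cr*br+ci*bi), ar*ci-ai*cr-(br*di-bi*dr);
    (ar^2+ai^2-cr^2-ci^2+br^2+bi^2-dr^2-di^2)/2, ar*br+ai*bi-(cr*dr+ci*di),
      -(ar*bi-ai*br-(cr*di-ci*dr)), (ar^2+ai^2-cr^2-ci^2-(br^2+bi^2-dr^2-di^2))/2]

lemma Lam_explicit (A : M2) : Lam A = LamE (A 0 0).re (A 0 0).im (A 0 1).re (A 0 1).im
    (A 1 0).re (A 1 0).im (A 1 1).re (A 1 1).im := by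
  ext i j
  fin_cases i <;> fin_cases j <;>
    simp [Lam, LamE, Matrix.mul_apply, pauli, Matrix.trace] <;> ring

set_option maxHeartbeats 2000000 in
lemma LamE_eta (ar ai br bi cr ci dr di : ℝ) :
    (LamE ar ai br bi cr ci dr di)ᵀ * η * LamE ar ai br bi cr ci dr di
      = ((ar*dr-ai*di-(br*cr-bi*ci))^2 + (ar*di+ai*dr-(br*ci+bi*cr))^2) • η := by
  ext i j
  fin_cases i <;> fin_cases j <;>
    simp [LamE, η, Matrix.mul_apply, Fin.sum_univ_four, Matrix.diagonal] <;> ring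

lemma Lam_eta (A : M2) (hA : A.det = 1) : (Lam A)ᵀ * η * Lam A = η := by
  have hr := congrArg Complex.re hA
  have hi := congrArg Complex.im hA
  simp [Matrix.det_fin_two] at hr hi
  rw [Lam_explicit, LamE_eta, hr, hi]
  simp

def Pm : Matrix (Fin 4) (Fin 2 × Fin 2) ℂ := Matrix.of fun i p => pauli i p.1 p.2

lemma Pm1 : Pm * ((1/2 : ℂ) • Pmᴴ) = 1 := by
  ext i j
  fin_cases i <;> fin_cases j <;>
    simp [Pm, Matrix.mul_apply, Fintype.sum_prod_type, pauli] <;> apply Complex.ext <;> simp <;> norm_num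

lemma Pm2 : ((1/2 : ℂ) • Pmᴴ) * Pm = 1 := by
  ext ⟨i, i'⟩ ⟨j, j'⟩
  fin_cases i <;> fin_cases j <;> fin_cases i' <;> fin_cases j' <;>
    simp [Pm, Matrix.mul_apply, Fin.sum_univ_four, pauli] <;> apply Complex.ext <;> simp <;> norm_num

lemma Lam_det (A : M2) (hA : A.det = 1) : (Lam A).det = 1 := by
  have h : (Lam A).map (Complex.ofRealHom) * Pm = Pm * ((A.map (starRingEnd ℂ)) ⊗ₖ A) := by
    ext i ⟨a, b⟩
    have := congrFun (congrFun (conj_pauli A i) a) b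
    simp only [Matrix.sum_apply, Matrix.smul_apply, smul_eq_mul] at this
    simp only [Matrix.mul_apply, Matrix.map_apply, Pm, Matrix.of_apply, Complex.ofRealHom_eq_coe]
    rw [← this]
    simp [Matrix.mul_apply, Fintype.sum_prod_type]
    ring
  have h2 : (Lam A).map (Complex.ofRealHom)
      = Pm * ((A.map (starRingEnd ℂ)) ⊗ₖ A) * ((1/2 : ℂ) • Pmᴴ) := by
    rw [← h, Matrix.mul_assoc, Pm1, Matrix.mul_one]
  have h3 := congrArg Matrix.det h2
  rw [Matrix.det_conj_of_mul_eq_one Pm1 Pm2, Matrix.det_kronecker] at h3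
  have h4 : (A.map (starRingEnd ℂ)).det = 1 := by
    have := (RingHom.map_det (starRingEnd ℂ) A).symm
    rw [hA, map_one] at this
    exact this
  rw [h4, hA] at h3
  have h5 := (RingHom.map_det Complex.ofRealHom (Lam A)).symm
  rw [RingHom.mapMatrix_apply, h3] at h5
  simp at h5
  exact_mod_cast h5.symm

lemma Lam_00 (A : M2) : Lam A 0 0 = (‖A 0 0‖^2 + ‖A 0 1‖^2 + ‖A 1 0‖^2 + ‖A 1 1‖^2) / 2 := by
  simp only [← Complex.normSq_eq_norm_sq, Complex.normSq_apply]
  simp [Lam, Matrix.mul_apply, pauli, Matrix.trace]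
  ring

lemma Lam_lor (A : M2) (hA : A.det = 1) : LorentzPO (Lam A) := by
  refine ⟨Lam_eta A hA, Lam_det A hA, ?_⟩
  rw [Lam_00]
  have h : ‖A 0 0 * A 1 1 - A 0 1 * A 1 0‖ = 1 := by
    rw [← Matrix.det_fin_two, hA]; simp
  have := norm_sub_le (A 0 0 * A 1 1) (A 0 1 * A 1 0)
  rw [norm_mul, norm_mul] at this
  nlinarith [sq_nonneg (‖A 0 0‖ - ‖A 1 1‖), sq_nonneg (‖A 0 1‖ - ‖A 1 0‖)]
def Nice (S : Matrix (Fin 4) (Fin 4) ℝ) : Prop :=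
  ((∃ s : Fin 4 → ℝ, S = Matrix.diagonal s ∧
          s 1 ≤ s 0 ∧ s 2 ≤ s 1 ∧ |s 3| ≤ s 2) ∨
       (∃ a b c d : ℝ,
          S = !![a, 0, 0, b; 0, d, 0, 0; 0, 0, d, 0; c, 0, 0, b + c - a] ∧
          ((b = a / 2 ∧ c = a / 2) ∨
           (d = 0 ∧ c = 0 ∧ b = a) ∨
           (d = 0 ∧ b = 0 ∧ c = a) ∨
           (d = 0 ∧ a = b ∧ b = c))))

/-- Some local filtering of `ρ` has a matrix in normal form. -/
def Good (ρ : M4) : Prop := ∃ A B : M2, A.det = 1 ∧ B.det = 1 ∧ Nice (Rmat (act A B ρ))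

lemma Good.of_act {ρ : M4} {A B : M2} (hA : A.det = 1) (hB : B.det = 1) (h : Good (act A B ρ)) :
    Good ρ := by
  obtain ⟨C, D, hC, hD, h⟩ := h
  refine ⟨C * A, D * B, by simp [hC, hA], by simp [hD, hB], ?_⟩
  rwa [act_act] at h

lemma Good.of_nice {ρ : M4} (h : Nice (Rmat ρ)) : Good ρ :=
  ⟨1, 1, by simp, by simp, by rwa [act_one]⟩

lemma Good.final {ρ : M4} (h : Good ρ) : ∃ (L1 L2 S : Matrix (Fin 4) (Fin 4) ℝ),
    LorentzPO L1 ∧ LorentzPO L2 ∧ Rmat ρ = L1 * S * L2ᵀ ∧ Nice S := by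
  obtain ⟨A, B, hA, hB, h⟩ := h
  refine ⟨Lam A⁻¹, Lam B⁻¹, _, Lam_lor _ (by simp [hA]), Lam_lor _ (by simp [hB]), ?_, h⟩
  rw [← Rmat_act, act_act, Matrix.nonsing_inv_mul A (by simp [hA]),
    Matrix.nonsing_inv_mul B (by simp [hB]), act_one]

def qf (ρ : M4) (a b : Fin 2 → ℂ) : ℂ :=
  ∑ p, ∑ q, a p.1 * b p.2 * ρ p q * star (a q.1 * b q.2)

lemma act_apply (A B : M2) (ρ : M4) (r s : Fin 2 × Fin 2) : act A B ρ r s =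
    ∑ p, ∑ q, A r.1 p.1 * B r.2 p.2 * ρ p q * star (A s.1 q.1 * B s.2 q.2) := by
  simp only [act, Matrix.mul_apply, Matrix.conjTranspose_apply, Matrix.kroneckerMap_apply,
    Finset.sum_mul]
  rw [Finset.sum_comm]

lemma act_diag (A B : M2) (ρ : M4) (r s : Fin 2) :
    act A B ρ (r, s) (r, s) = qf ρ (A r) (B s) := by
  rw [act_apply]; rfl

lemma qf_eq (ρ : M4) (a b : Fin 2 → ℂ) : qf ρ a b =
    star (fun p : Fin 2 × Fin 2 => star (a p.1 * b p.2)) ⬝ᵥ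
      (ρ *ᵥ (fun p : Fin 2 × Fin 2 => star (a p.1 * b p.2))) := by
  simp only [qf, dotProduct, Matrix.mulVec, Finset.mul_sum, Pi.star_apply, star_star]
  refine Finset.sum_congr rfl fun k _ => Finset.sum_congr rfl fun l _ => ?_
  ring

lemma qf_nonneg {ρ : M4} (h : ρ.PosSemidef) (a b : Fin 2 → ℂ) : 0 ≤ qf ρ a b := by
  rw [qf_eq]; exact h.dotProduct_mulVec_nonneg _

lemma psd_row_zero {ρ : M4} (h : ρ.PosSemidef) (p : Fin 2 × Fin 2) (hp : ρ p p = 0) :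
    ∀ q, ρ q p = 0 ∧ ρ p q = 0 := by
  have h1 : ρ *ᵥ (Pi.single p 1) = 0 := by
    rw [← h.dotProduct_mulVec_zero_iff]
    simp [hp]
  intro q
  have h2 : ρ q p = 0 := by simpa using congrFun h1 q
  refine ⟨h2, ?_⟩
  rw [← h.1.apply, h2, star_zero]

lemma exists_row (x : Fin 2 → ℂ) (hx : x ≠ 0) : ∃ A : M2, A.det = 1 ∧ A 1 = x := by
  by_cases h0 : x 0 = 0
  · have h1 : x 1 ≠ 0 := by
      intro h1; apply hx; ext i; fin_cases i <;> simp [h0, h1]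
    refine ⟨!![(x 1)⁻¹, 0; x 0, x 1], by simp [Matrix.det_fin_two, h1], ?_⟩
    ext i; fin_cases i <;> simp
  · refine ⟨!![0, -(x 0)⁻¹; x 0, x 1], by simp [Matrix.det_fin_two, h0], ?_⟩
    ext i; fin_cases i <;> simp

/-- Canonical matrix with a product vector in its kernel. -/
def can (x y z d : ℂ) : M4 := Matrix.of fun p q =>
  (![![![![x, 0], ![0, 0]], ![![0, y], ![d, 0]]],
    ![![![0, star d], ![z, 0]], ![![0, 0], ![0, 0]]]] : Fin 2 → Fin 2 → Fin 2 → Fin 2 → ℂ)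
    p.1 p.2 q.1 q.2

lemma act_can (x y z d s t : ℂ) : act !![s, 0; 0, s⁻¹] !![t, 0; 0, t⁻¹] (can x y z d) =
    can (s * t * x * star (s * t)) (s * t⁻¹ * y * star (s * t⁻¹))
      (s⁻¹ * t * z * star (s⁻¹ * t)) (s * t⁻¹ * d * star (s⁻¹ * t)) := by
  ext ⟨i, j⟩ ⟨k, l⟩
  rw [act_apply]
  fin_cases i <;> fin_cases j <;> fin_cases k <;> fin_cases l <;>
    simp [can, Fintype.sum_prod_type] <;> ring

lemma Rmat_can (x y z d : ℝ) : Rmat (can x y z d) =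
    !![x + y + z, 0, 0, x - y + z; 0, 2 * d, 0, 0; 0, 0, 2 * d, 0;
      x + y - z, 0, 0, x - y - z] := by
  ext i j
  fin_cases i <;> fin_cases j <;>
    simp [Rmat, can, Matrix.trace, Matrix.mul_apply, pauli, Fintype.sum_prod_type,
      Matrix.kroneckerMap_apply] <;> ring

lemma null_step1 {ρ : M4} (h : ρ.PosSemidef) (h0 : ρ (1,1) (1,1) = 0) :
    ∃ e f : ℂ, ∃ x y z d : ℂ, act !![1, e; 0, 1] !![1, f; 0, 1] ρ = can x y z d := by
  have hz := psd_row_zero h _ h0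
  have hs : ∀ p q, star (ρ p q) = ρ q p := fun p q => h.1.apply q p
  have key : ∃ e f : ℂ,
      f * ρ (0,1) (0,1) + e * ρ (1,0) (0,1) = - ρ (0,0) (0,1) ∧
      f * ρ (0,1) (1,0) + e * ρ (1,0) (1,0) = - ρ (0,0) (1,0) := by
    by_cases hD : ρ (0,1) (0,1) * ρ (1,0) (1,0) - ρ (0,1) (1,0) * ρ (1,0) (0,1) = 0
    · by_cases hy : ρ (0,1) (0,1) = 0
      · have hy' := psd_row_zero h _ hy
        by_cases hzz : ρ (1,0) (1,0) = 0
        · have hz' := psd_row_zero h _ hzz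
          exact ⟨0, 0, by simp [(hy' (0,0)).1], by simp [(hz' (0,0)).1]⟩
        · refine ⟨-ρ (0,0) (1,0) / ρ (1,0) (1,0), 0, ?_, ?_⟩
          · simp [(hy' (0,0)).1, (hy' (1,0)).1]
          · field_simp; simp
      · refine ⟨0, -ρ (0,0) (0,1) / ρ (0,1) (0,1), ?_, ?_⟩
        · field_simp; simp
        · have hk : ρ *ᵥ (fun p => (![![0, ρ (0,1) (1,0)], ![-ρ (0,1) (0,1), 0]] :
              Fin 2 → Fin 2 → ℂ) p.1 p.2) = 0 := by
            rw [← h.dotProduct_mulVec_zero_iff]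
            simp [dotProduct, Matrix.mulVec, Fintype.sum_prod_type]
            have hs1 := hs (0,1) (1,0)
            have hs2 := hs (0,1) (0,1)
            simp at hs1 hs2
            rw [hs1, hs2]
            linear_combination (ρ (0,1) (0,1)) * hD
          have := congrFun hk (0,0)
          simp [dotProduct, Matrix.mulVec, Fintype.sum_prod_type] at this
          field_simp
          linear_combination -this
    · set D := ρ (0,1) (0,1) * ρ (1,0) (1,0) - ρ (0,1) (1,0) * ρ (1,0) (0,1) with hDd
      refine ⟨(-ρ (0,0) (1,0) * ρ (0,1) (0,1) + ρ (0,0) (0,1) * ρ (0,1) (1,0)) / D,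
        (-ρ (0,0) (0,1) * ρ (1,0) (1,0) + ρ (0,0) (1,0) * ρ (1,0) (0,1)) / D, ?_, ?_⟩
      · field_simp; rw [hDd]; ring
      · field_simp; rw [hDd]; ring
  obtain ⟨e, f, h1, h2⟩ := key
  refine ⟨e, f, act !![1, e; 0, 1] !![1, f; 0, 1] ρ (0,0) (0,0), ρ (0,1) (0,1), ρ (1,0) (1,0),
    ρ (0,1) (1,0), ?_⟩
  have h1' := congrArg star h1
  have h2' := congrArg star h2
  simp only [star_add, star_mul', star_neg, hs] at h1' h2'
  have z1 := fun q => (hz q).1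
  have z2 := fun q => (hz q).2
  have hs1 := hs (0,1) (1,0)
  ext ⟨i, j⟩ ⟨k, l⟩
  fin_cases i <;> fin_cases j <;> fin_cases k <;> fin_cases l <;>
    simp [can, act_apply, Fintype.sum_prod_type, z1, z2]
  · linear_combination h1
  · linear_combination h2
  · simp at h1'; linear_combination h1'
  · simp at h2'; linear_combination h2'
  · simpa using hs1.symm

lemma exists_st (p q : ℝ) (hp : 0 < p) (hq : 0 < q) : ∃ s t : ℝ, 0 < s ∧ 0 < t ∧
    s^2 * t^2 = p ∧ s^2 / t^2 = q := by
  refine ⟨√(√(p * q)), √(√(p / q)), by positivity, by positivity, ?_, ?_⟩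
  · rw [Real.sq_sqrt (by positivity), Real.sq_sqrt (by positivity),
      ← Real.sqrt_mul (by positivity)]
    rw [Real.sqrt_eq_iff_mul_self_eq (by positivity) (by positivity)]
    field_simp
  · rw [Real.sq_sqrt (by positivity), Real.sq_sqrt (by positivity),
      ← Real.sqrt_div (by positivity)]
    rw [Real.sqrt_eq_iff_mul_self_eq (by positivity) (by positivity)]
    field_simp
set_option linter.unusedSimpArgs false
lemma box_compact (r : ℝ) : IsCompact {A : M2 | ∀ i j, ‖A i j‖ ≤ r} := by
  have : IsCompact (Set.pi Set.univ fun _ : Fin 2 => Set.pi Set.univ fun _ : Fin 2 =>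
      Metric.closedBall (0 : ℂ) r) :=
    isCompact_univ_pi fun _ => isCompact_univ_pi fun _ => isCompact_closedBall _ _
  have e : {A : M2 | ∀ i j, ‖A i j‖ ≤ r} = {A : M2 | ∀ i ∈ Set.univ, ∀ j ∈ Set.univ,
      A i j ∈ Metric.closedBall (0 : ℂ) r} := by
    ext A
    simp
  rw [e]
  exact this

lemma cont_act (ρ : M4) (r s : Fin 2 × Fin 2) :
    Continuous fun P : M2 × M2 => act P.1 P.2 ρ r s := by
  simp_rw [act_apply]
  have h1 : ∀ i j, Continuous fun P : M2 × M2 => P.1 i j := fun i j => by fun_prop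
  have h2 : ∀ i j, Continuous fun P : M2 × M2 => P.2 i j := fun i j => by fun_prop
  refine continuous_finsetSum _ fun p _ => continuous_finsetSum _ fun q _ => ?_
  exact (((h1 _ _).mul (h2 _ _)).mul continuous_const).mul ((h1 _ _).mul (h2 _ _)).star

lemma cont_R (ρ : M4) (i j : Fin 4) :
    Continuous fun P : M2 × M2 => Rmat (act P.1 P.2 ρ) i j := by
  simp only [Rmat, Matrix.of_apply, Matrix.trace, Matrix.diag_apply]
  refine Complex.continuous_re.comp (continuous_finsetSum _ fun p _ => ?_)
  simp_rw [Matrix.mul_apply]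
  exact continuous_finsetSum _ fun q _ => (cont_act ρ _ _).mul continuous_const

lemma cont_det : Continuous fun A : M2 => A.det := Continuous.matrix_det continuous_id

def Rot1 (C S : ℝ) : Matrix (Fin 4) (Fin 4) ℝ :=
  !![1, 0, 0, 0; 0, 1, 0, 0; 0, 0, C, S; 0, 0, -S, C]
def Rot2 (C S : ℝ) : Matrix (Fin 4) (Fin 4) ℝ :=
  !![1, 0, 0, 0; 0, C, 0, -S; 0, 0, 1, 0; 0, S, 0, C]
def Rot3 (C S : ℝ) : Matrix (Fin 4) (Fin 4) ℝ :=
  !![1, 0, 0, 0; 0, C, S, 0; 0, -S, C, 0; 0, 0, 0, 1]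

def SU : Set M2 := {U | Uᴴ * U = 1 ∧ U.det = 1}

lemma SU_compact : IsCompact SU := by
  refine (box_compact 1).of_isClosed_subset ?_ ?_
  · refine IsClosed.inter (isClosed_eq ?_ continuous_const) (isClosed_eq cont_det continuous_const)
    fun_prop
  · intro U hU i j
    exact entry_norm_bound_of_unitary (Matrix.mem_unitaryGroup_iff'.2 hU.1) i j

lemma SU_mul {U V : M2} (hU : U ∈ SU) (hV : V ∈ SU) : U * V ∈ SU := by
  refine ⟨?_, by simp [hU.2, hV.2]⟩
  rw [Matrix.conjTranspose_mul, Matrix.mul_assoc, ← Matrix.mul_assoc Uᴴ, hU.1, Matrix.one_mul, hV.1]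

lemma SU_one : (1 : M2) ∈ SU := by simp [SU]

lemma mem_SU_of (a b : ℂ) (h : a * star a + b * star b = 1) : !![a, b; -star b, star a] ∈ SU := by
  constructor
  · ext i j
    fin_cases i <;> fin_cases j <;> simp [Matrix.mul_apply, Fin.sum_univ_two] at h ⊢
    · linear_combination h
    · ring
    · ring
    · linear_combination h
  · simp [Matrix.det_fin_two] at h ⊢
    linear_combination h

lemma Lam_SU_row {U : M2} (hU : U ∈ SU) (k : Fin 4) : Lam U 0 k = if k = 0 then 1 else 0 := by
  have : Uᴴ * pauli 0 * U = 1 := by simp [pauli, hU.1]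
  simp only [Lam, Matrix.of_apply, this]
  fin_cases k <;> simp [pauli, Matrix.trace]

lemma Lam_SU_col {U : M2} (hU : U ∈ SU) (k : Fin 4) : Lam U k 0 = if k = 0 then 1 else 0 := by
  have h1 : U * Uᴴ = 1 := mul_eq_one_comm.1 hU.1
  have : (Uᴴ * pauli k * U * pauli 0).trace = (pauli k).trace := by
    have : pauli 0 = 1 := rfl
    rw [this, Matrix.mul_one, Matrix.trace_mul_comm, ← Matrix.mul_assoc, h1, Matrix.one_mul]
  simp only [Lam, Matrix.of_apply, this]
  fin_cases k <;> simp [pauli, Matrix.trace]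

lemma Lam_one : Lam 1 = 1 := by
  rw [Lam_explicit]
  ext i j
  fin_cases i <;> fin_cases j <;> simp [LamE] 

lemma rot1 (c s : ℝ) (h : c^2 + s^2 = 1) : ∃ U ∈ SU, Lam U = Rot1 (c^2-s^2) (2*(c*s)) := by
  have h' : (c : ℂ)^2 + (s : ℂ)^2 = 1 := by exact_mod_cast h
  refine ⟨_, mem_SU_of (c : ℂ) (s * Complex.I) ?_, ?_⟩
  · simp; linear_combination h' - s^2 * Complex.I_sq
  · rw [Lam_explicit]
    ext i j
    fin_cases i <;> fin_cases j <;> simp [LamE, Rot1] <;> linarith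

lemma rot2 (c s : ℝ) (h : c^2 + s^2 = 1) : ∃ U ∈ SU, Lam U = Rot2 (c^2-s^2) (2*(c*s)) := by
  have h' : (c : ℂ)^2 + (s : ℂ)^2 = 1 := by exact_mod_cast h
  refine ⟨_, mem_SU_of (c : ℂ) (s : ℂ) ?_, ?_⟩
  · simp; linear_combination h'
  · rw [Lam_explicit]
    ext i j
    fin_cases i <;> fin_cases j <;> simp [LamE, Rot2] <;> linarith

lemma rot3 (c s : ℝ) (h : c^2 + s^2 = 1) : ∃ U ∈ SU, Lam U = Rot3 (c^2-s^2) (2*(c*s)) := by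
  have h' : (c : ℂ)^2 + (s : ℂ)^2 = 1 := by exact_mod_cast h
  refine ⟨_, mem_SU_of (c + s * Complex.I : ℂ) 0 ?_, ?_⟩
  · simp; linear_combination h' - s^2 * Complex.I_sq
  · rw [Lam_explicit]
    ext i j
    fin_cases i <;> fin_cases j <;> simp [LamE, Rot3] <;> linarith

lemma crit (X Y : ℝ) (h : ∀ c s : ℝ, c^2 + s^2 = 1 → c * s * Y ≤ s^2 * X) : Y = 0 := by
  have h2 : ∀ c : ℝ, c * Y ≤ X := by
    intro c
    have hp : 0 < c^2 + 1 := by positivity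
    have hr : √(c^2+1) ^ 2 = c^2 + 1 := Real.sq_sqrt hp.le
    have h3 := h (c / √(c^2+1)) (1 / √(c^2+1)) (by rw [div_pow, div_pow, hr]; field_simp)
    have e1 : c / √(c^2+1) * (1 / √(c^2+1)) * Y = (c * Y) / (c^2+1) := by
      rw [div_mul_div_comm, mul_one, ← sq, hr]; ring
    have e2 : (1 / √(c^2+1))^2 * X = X / (c^2+1) := by
      rw [div_pow, hr]; ring
    rw [e1, e2] at h3
    exact (div_le_div_iff_of_pos_right hp).1 h3
  by_contra hY
  have := h2 ((X + 1) / Y)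
  rw [div_mul_cancel₀ _ hY] at this
  linarith

def gf (R : Matrix (Fin 4) (Fin 4) ℝ) : ℝ := 3 * R 1 1 + 2 * R 2 2 + R 3 3

lemma svd_core (R : Matrix (Fin 4) (Fin 4) ℝ)
    (hmax : ∀ U ∈ SU, ∀ V ∈ SU, gf (Lam U * R * (Lam V)ᵀ) ≤ gf R)
    (h0 : ∀ k, k ≠ 0 → R 0 k = 0) (h0' : ∀ k, k ≠ 0 → R k 0 = 0) :
    R = Matrix.diagonal (fun i => R i i) ∧ R 2 2 ≤ R 1 1 ∧ |R 3 3| ≤ R 2 2 := by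
  have L1 : 3 * R 1 2 - 2 * R 2 1 = 0 ∧ 3 * R 2 1 - 2 * R 1 2 = 0 := by
    constructor
    · refine crit (3 * R 1 1 + 2 * R 2 2) _ fun c s h => ?_
      obtain ⟨U, hU, hL⟩ := rot3 c s h
      have := hmax 1 SU_one U hU
      rw [hL, Lam_one] at this
      simp [gf, Matrix.mul_apply, Fin.sum_univ_four, Rot3, Matrix.vecMul, dotProduct, h0, h0'] at this
      have hc : c^2 = 1 - s^2 := by linarith
      rw [hc] at this
      linarith
    · refine crit (3 * R 1 1 + 2 * R 2 2) _ fun c s h => ?_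
      obtain ⟨U, hU, hL⟩ := rot3 c s h
      have := hmax U hU 1 SU_one
      rw [hL, Lam_one] at this
      simp [gf, Matrix.mul_apply, Fin.sum_univ_four, Rot3, Matrix.vecMul, dotProduct, h0, h0'] at this
      have hc : c^2 = 1 - s^2 := by linarith
      rw [hc] at this
      linarith
  have L2 : R 3 1 - 3 * R 1 3 = 0 ∧ R 1 3 - 3 * R 3 1 = 0 := by
    constructor
    · refine crit (3 * R 1 1 + R 3 3) _ fun c s h => ?_
      obtain ⟨U, hU, hL⟩ := rot2 c s h
      have := hmax 1 SU_one U hU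
      rw [hL, Lam_one] at this
      simp [gf, Matrix.mul_apply, Fin.sum_univ_four, Rot2, Matrix.vecMul, dotProduct, h0, h0'] at this
      have hc : c^2 = 1 - s^2 := by linarith
      rw [hc] at this
      linarith
    · refine crit (3 * R 1 1 + R 3 3) _ fun c s h => ?_
      obtain ⟨U, hU, hL⟩ := rot2 c s h
      have := hmax U hU 1 SU_one
      rw [hL, Lam_one] at this
      simp [gf, Matrix.mul_apply, Fin.sum_univ_four, Rot2, Matrix.vecMul, dotProduct, h0, h0'] at this
      have hc : c^2 = 1 - s^2 := by linarith
      rw [hc] at this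
      linarith
  have L3 : 2 * R 2 3 - R 3 2 = 0 ∧ 2 * R 3 2 - R 2 3 = 0 := by
    constructor
    · refine crit (2 * R 2 2 + R 3 3) _ fun c s h => ?_
      obtain ⟨U, hU, hL⟩ := rot1 c s h
      have := hmax 1 SU_one U hU
      rw [hL, Lam_one] at this
      simp [gf, Matrix.mul_apply, Fin.sum_univ_four, Rot1, Matrix.vecMul, dotProduct, h0, h0'] at this
      have hc : c^2 = 1 - s^2 := by linarith
      rw [hc] at this
      linarith
    · refine crit (2 * R 2 2 + R 3 3) _ fun c s h => ?_
      obtain ⟨U, hU, hL⟩ := rot1 c s h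
      have := hmax U hU 1 SU_one
      rw [hL, Lam_one] at this
      simp [gf, Matrix.mul_apply, Fin.sum_univ_four, Rot1, Matrix.vecMul, dotProduct, h0, h0'] at this
      have hc : c^2 = 1 - s^2 := by linarith
      rw [hc] at this
      linarith
  have hd : R = Matrix.diagonal (fun i => R i i) := by
    ext i j
    fin_cases i <;> fin_cases j <;> simp [h0, h0'] <;> linarith [L1.1, L1.2, L2.1, L2.2, L3.1, L3.2]
  have hr : √(1/2 : ℝ) ^ 2 = 1/2 := Real.sq_sqrt (by norm_num)
  have hr' : √(1/2 : ℝ) * √(1/2 : ℝ) = 1/2 := by rw [← sq, hr]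
  obtain ⟨U3, hU3, hL3⟩ := rot3 (√(1/2)) (√(1/2)) (by rw [hr]; norm_num)
  obtain ⟨U1, hU1, hL1⟩ := rot1 (√(1/2)) (√(1/2)) (by rw [hr]; norm_num)
  obtain ⟨V1, hV1, hM1⟩ := rot1 (√(1/2)) (-√(1/2)) (by rw [neg_sq, hr]; norm_num)
  rw [hr, hr', sub_self] at hL3 hL1
  rw [mul_neg, neg_sq, hr, hr', sub_self] at hM1
  have a1 := hmax U3 hU3 U3 hU3
  have a2 := hmax U1 hU1 U1 hU1
  have a3 := hmax U1 hU1 V1 hV1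
  rw [hL3] at a1
  rw [hL1] at a2
  rw [hL1, hM1] at a3
  simp [gf, Matrix.mul_apply, Fin.sum_univ_four, Rot1, Rot3, Matrix.vecMul, dotProduct, h0, h0'] at a1 a2 a3
  refine ⟨hd, by linarith, abs_le.2 ⟨by linarith, by linarith⟩⟩

lemma R_qf (ρ : M4) : Rmat ρ 0 0 - Rmat ρ 1 1 + Rmat ρ 1 0 - Rmat ρ 0 1
    = (qf ρ ![1, 1] ![1, -1]).re := by
  simp [Rmat, qf, Matrix.trace, Matrix.mul_apply, pauli, Fintype.sum_prod_type,
      Matrix.kroneckerMap_apply]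
  ring

lemma good_svd {ρ : M4} (h : ρ.PosSemidef)
    (h0 : ∀ k, k ≠ 0 → Rmat ρ 0 k = 0) (h0' : ∀ k, k ≠ 0 → Rmat ρ k 0 = 0) : Good ρ := by
  have hc : Continuous fun P : M2 × M2 => gf (Rmat (act P.1 P.2 ρ)) := by
    unfold gf
    exact (((cont_R ρ 1 1).const_mul 3).add ((cont_R ρ 2 2).const_mul 2)).add (cont_R ρ 3 3)
  obtain ⟨⟨U, V⟩, hUV, hm⟩ := (SU_compact.prod SU_compact).exists_isMaxOn
    ⟨(1, 1), SU_one, SU_one⟩ hc.continuousOn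
  obtain ⟨hU, hV⟩ := hUV
  simp only at hU hV
  refine Good.of_act hU.2 hV.2 (Good.of_nice (Or.inl ?_))
  have hR : Rmat (act U V ρ) = Lam U * Rmat ρ * (Lam V)ᵀ := Rmat_act _ _ _
  have g0 : ∀ k, k ≠ 0 → Rmat (act U V ρ) 0 k = 0 := by
    intro k hk
    rw [hR]
    simp [Matrix.mul_apply, Fin.sum_univ_four, Lam_SU_row hU, h0, Lam_SU_col hV, hk]
  have g0' : ∀ k, k ≠ 0 → Rmat (act U V ρ) k 0 = 0 := by
    intro k hk
    rw [hR]
    simp [Matrix.mul_apply, Fin.sum_univ_four, Lam_SU_row hV, h0', Lam_SU_col hU, hk]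
  obtain ⟨hd, h1, h2⟩ := svd_core (Rmat (act U V ρ)) (by
    intro U' hU' V' hV'
    rw [← Rmat_act, act_act]
    exact hm (a := (U' * U, V' * V)) ⟨SU_mul hU' hU, SU_mul hV' hV⟩) g0 g0'
  refine ⟨_, hd, ?_, h1, h2⟩
  have hq := (Complex.le_def.1 (qf_nonneg (act_psd U V h) ![1, 1] ![1, -1])).1
  rw [← R_qf, g0 1 (by decide), g0' 1 (by decide)] at hq
  simp at hq
  exact hq
lemma good_can_scale (x y z d p q x' y' z' : ℝ) (hp : 0 < p) (hq : 0 < q)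
    (hx : x * p = x') (hy : y * q = y') (hz : z / q = z')
    (h0 : (can x y z d).PosSemidef)
    (h : (can x' y' z' d).PosSemidef → Good (can x' y' z' d)) :
    Good (can x y z d) := by
  obtain ⟨s, t, hs, ht, h1, h2⟩ := exists_st p q hp hq
  have hs' : (s : ℂ) ≠ 0 := by exact_mod_cast hs.ne'
  have ht' : (t : ℂ) ≠ 0 := by exact_mod_cast ht.ne'
  have e : act !![(s : ℂ), 0; 0, (s : ℂ)⁻¹] !![(t : ℂ), 0; 0, (t : ℂ)⁻¹] (can x y z d)
      = can x' y' z' d := by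
    rw [act_can]
    congr 1
    · rw [← hx, ← h1]; simp; ring
    · rw [← hy, ← h2]; simp; field_simp
    · rw [← hz, ← h2]; simp; field_simp
    · simp; field_simp
  refine Good.of_act (A := !![(s : ℂ), 0; 0, (s : ℂ)⁻¹]) (B := !![(t : ℂ), 0; 0, (t : ℂ)⁻¹])
    (by simp [Matrix.det_fin_two, hs']) (by simp [Matrix.det_fin_two, ht']) ?_
  rw [e]
  exact h (e ▸ act_psd _ _ h0)

lemma good_can_pure (x : ℝ) : Good (can x (0 : ℝ) (0 : ℝ) (0 : ℝ)) := by
  refine Good.of_nice (Or.inr ⟨x, x, x, 0, ?_, by simp⟩)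
  rw [Rmat_can]; simp

lemma good_can (x y z d : ℝ) (hx : 0 ≤ x) (hy : 0 ≤ y) (hz : 0 ≤ z)
    (hyd : y = 0 → d = 0) (hzd : z = 0 → d = 0)
    (h0 : (can x y z d).PosSemidef) : Good (can x y z d) := by
  rcases hy.eq_or_lt with hy | hy
  · have hd := hyd hy.symm
    subst hy; subst hd
    rcases hz.eq_or_lt with hz | hz
    · subst hz; exact good_can_pure x
    rcases hx.eq_or_lt with hx | hx
    · subst hx
      refine Good.of_act (A := !![0, 1; -1, 0]) (B := !![1, 0; 0, 1]) (by simp [Matrix.det_fin_two])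
        (by simp [Matrix.det_fin_two]) ?_
      convert good_can_pure z using 1
      ext ⟨i, j⟩ ⟨k, l⟩
      rw [act_apply]
      fin_cases i <;> fin_cases j <;> fin_cases k <;> fin_cases l <;>
        simp [can, Fintype.sum_prod_type]
    · refine good_can_scale x 0 z 0 (z / x) 1 z 0 z (by positivity) one_pos (by field_simp)
        (by simp) (by simp) h0 fun _ => ?_
      refine Good.of_nice (Or.inr ⟨2 * z, 2 * z, 0, 0, ?_, by simp⟩)
      rw [Rmat_can]
      ext i j; fin_cases i <;> fin_cases j <;> simp <;> ring
  rcases hz.eq_or_lt with hz | hz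
  · have hd := hzd hz.symm
    subst hz; subst hd
    rcases hx.eq_or_lt with hx | hx
    · subst hx
      refine Good.of_act (A := !![1, 0; 0, 1]) (B := !![0, 1; -1, 0])
        (by simp [Matrix.det_fin_two]) (by simp [Matrix.det_fin_two]) ?_
      convert good_can_pure y using 1
      ext ⟨i, j⟩ ⟨k, l⟩
      rw [act_apply]
      fin_cases i <;> fin_cases j <;> fin_cases k <;> fin_cases l <;>
        simp [can, Fintype.sum_prod_type]
    · refine good_can_scale x y 0 0 (y / x) 1 y y 0 (by positivity) one_pos (by field_simp)
        (by simp) (by simp) h0 fun _ => ?_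
      refine Good.of_nice (Or.inr ⟨2 * y, 0, 2 * y, 0, ?_, by simp⟩)
      rw [Rmat_can]
      ext i j; fin_cases i <;> fin_cases j <;> simp <;> ring
  have hm : 0 < √(y * z) := by positivity
  have hm2 : √(y * z) ^ 2 = y * z := Real.sq_sqrt (by positivity)
  set m := √(y * z)
  have e2 : y * (m / y) = m := by field_simp
  have e3 : z / (m / y) = m := by field_simp; linarith
  rcases hx.eq_or_lt with hx | hx
  · subst hx
    refine good_can_scale 0 y z d 1 (m / y) 0 m m one_pos (by positivity) (by simp) e2 e3 h0
      fun hp => good_svd hp ?_ ?_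
    · intro k hk; rw [Rmat_can]; fin_cases k <;> simp at hk ⊢
    · intro k hk; rw [Rmat_can]; fin_cases k <;> simp at hk ⊢
  · refine good_can_scale x y z d (2 * m / x) (m / y) (2 * m) m m (by positivity) (by positivity)
      (by field_simp) e2 e3 h0 fun hp => ?_
    refine Good.of_nice (Or.inr ⟨4 * m, 2 * m, 2 * m, 2 * d, ?_, Or.inl ⟨by ring, by ring⟩⟩)
    rw [Rmat_can]
    ext i j; fin_cases i <;> fin_cases j <;> simp <;> ring

lemma good_can_complex (x y z d : ℂ) (h : (can x y z d).PosSemidef) : Good (can x y z d) := by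
  have hd : ∀ p, 0 ≤ (can x y z d) p p := fun p => h.diag_nonneg
  have hx := Complex.le_def.1 (hd (0,0))
  have hy := Complex.le_def.1 (hd (0,1))
  have hz := Complex.le_def.1 (hd (1,0))
  simp [can] at hx hy hz
  have ex : x = (x.re : ℂ) := Complex.ext (by simp) (by simp [← hx.2])
  have ey : y = (y.re : ℂ) := Complex.ext (by simp) (by simp [← hy.2])
  have ez : z = (z.re : ℂ) := Complex.ext (by simp) (by simp [← hz.2])
  have hyd : y = 0 → d = 0 := by
    intro h1
    have := (psd_row_zero h (0,1) (by simpa [can] using h1) (1,0)).2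
    simpa [can] using this
  have hzd : z = 0 → d = 0 := by
    intro h1
    have := (psd_row_zero h (1,0) (by simpa [can] using h1) (0,1)).1
    simpa [can] using this
  obtain ⟨u, hu, hud⟩ : ∃ u : ℂ, u * star u = 1 ∧ u * d * u = (‖d‖ : ℂ) := by
    refine ⟨Complex.exp (-(d.arg / 2 : ℝ) * Complex.I), ?_, ?_⟩
    · rw [Complex.star_def, ← Complex.exp_conj, ← Complex.exp_add]
      simp only [map_mul, map_neg, Complex.conj_ofReal, Complex.conj_I]
      ring_nf
      simp
    · rw [mul_right_comm, ← Complex.exp_add]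
      nth_rewrite 3 [← Complex.norm_mul_exp_arg_mul_I d]
      rw [mul_left_comm, ← Complex.exp_add]
      have : -((d.arg / 2 : ℝ) : ℂ) * Complex.I + -((d.arg / 2 : ℝ) : ℂ) * Complex.I
        + d.arg * Complex.I = 0 := by push_cast; ring
      rw [this]; simp
  have hu0 : u ≠ 0 := by rintro rfl; simp at hu
  have hinv : star u = u⁻¹ := eq_inv_of_mul_eq_one_right hu
  have hinv' : star (u⁻¹) = u := by rw [← hinv, star_star]
  have e : act !![u, 0; 0, u⁻¹] !![1, 0; 0, 1⁻¹] (can x y z d)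
      = can (x.re : ℂ) (y.re : ℂ) (z.re : ℂ) (‖d‖ : ℂ) := by
    rw [act_can]
    simp only [mul_one, inv_one, hinv, hinv', ← ex, ← ey, ← ez, hud]
    congr 1 <;> field_simp
  refine Good.of_act (A := !![u, 0; 0, u⁻¹]) (B := !![1, 0; 0, 1⁻¹])
    (by simp [Matrix.det_fin_two, hu0]) (by simp [Matrix.det_fin_two]) ?_
  rw [e]
  refine good_can _ _ _ _ hx.1 hy.1 hz.1 ?_ ?_ (e ▸ act_psd _ _ h)
  · intro h1; rw [hyd (by rw [ey, h1]; simp)]; simp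
  · intro h1; rw [hzd (by rw [ez, h1]; simp)]; simp

lemma good_null {ρ : M4} (h : ρ.PosSemidef) (a b : Fin 2 → ℂ) (ha : a ≠ 0) (hb : b ≠ 0)
    (hq : qf ρ a b = 0) : Good ρ := by
  obtain ⟨A, hA, rfl⟩ := exists_row a ha
  obtain ⟨B, hB, rfl⟩ := exists_row b hb
  refine Good.of_act hA hB ?_
  have hp := act_psd A B h
  obtain ⟨e, f, x, y, z, d, hc⟩ := null_step1 hp (by rw [act_diag, hq])
  refine Good.of_act (A := !![1, e; 0, 1]) (B := !![1, f; 0, 1])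
    (by simp [Matrix.det_fin_two]) (by simp [Matrix.det_fin_two]) ?_
  have hp2 := act_psd !![1, e; 0, 1] !![1, f; 0, 1] hp
  rw [hc] at hp2 ⊢
  exact good_can_complex _ _ _ _ hp2
lemma qf_smul (ρ : M4) (r t : ℝ) (a b : Fin 2 → ℂ) :
    (qf ρ (r • a) (t • b)).re = r^2 * t^2 * (qf ρ a b).re := by
  have : qf ρ (r • a) (t • b) = ((r^2 * t^2 : ℝ) : ℂ) * qf ρ a b := by
    simp only [qf, Finset.mul_sum, Pi.smul_apply, Complex.real_smul]
    refine Finset.sum_congr rfl fun k _ => Finset.sum_congr rfl fun l _ => ?_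
    simp
    ring
  rw [this, Complex.re_ofReal_mul]

lemma qf_cont (ρ : M4) : Continuous fun P : (Fin 2 → ℂ) × (Fin 2 → ℂ) => (qf ρ P.1 P.2).re := by
  unfold qf
  fun_prop

lemma qf_lower {ρ : M4} (h : ρ.PosSemidef)
    (hpos : ∀ a b : Fin 2 → ℂ, a ≠ 0 → b ≠ 0 → qf ρ a b ≠ 0) :
    ∃ c : ℝ, 0 < c ∧ ∀ a b, c * (‖a‖^2 * ‖b‖^2) ≤ (qf ρ a b).re := by
  have h1 : ‖(fun _ => 1 : Fin 2 → ℂ)‖ = 1 := by simp [pi_norm_const]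
  obtain ⟨⟨a0, b0⟩, ⟨ha0, hb0⟩, hm⟩ := ((isCompact_sphere (0 : Fin 2 → ℂ) 1).prod
    (isCompact_sphere (0 : Fin 2 → ℂ) 1)).exists_isMinOn
    ⟨(fun _ => 1, fun _ => 1), by simp, by simp⟩ (qf_cont ρ).continuousOn
  simp at ha0 hb0
  have hp : ∀ a b, 0 ≤ (qf ρ a b).re := fun a b => (Complex.le_def.1 (qf_nonneg h a b)).1
  refine ⟨(qf ρ a0 b0).re, ?_, ?_⟩
  · refine lt_of_le_of_ne (hp _ _) fun h0 => ?_
    refine hpos a0 b0 (by rintro rfl; simp at ha0) (by rintro rfl; simp at hb0) ?_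
    exact Complex.ext h0.symm (Complex.le_def.1 (qf_nonneg h a0 b0)).2.symm
  · intro a b
    by_cases ha : a = 0
    · subst ha; simpa using hp _ _
    by_cases hb : b = 0
    · subst hb; simpa using hp _ _
    have ha' := norm_ne_zero_iff.2 ha
    have hb' := norm_ne_zero_iff.2 hb
    have h2 : (qf ρ a0 b0).re ≤ (qf ρ (‖a‖⁻¹ • a) (‖b‖⁻¹ • b)).re := by
      refine hm (a := (‖a‖⁻¹ • a, ‖b‖⁻¹ • b)) ⟨?_, ?_⟩
      · simp [norm_smul, ha']
      · simp [norm_smul, hb']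
    rw [qf_smul] at h2
    have h3 : 0 < ‖a‖^2 * ‖b‖^2 := by positivity
    calc _ ≤ ‖a‖⁻¹ ^ 2 * ‖b‖⁻¹ ^ 2 * (qf ρ a b).re * (‖a‖^2 * ‖b‖^2) := by gcongr
      _ = _ := by field_simp

lemma R00_eq (ρ : M4) (A B : M2) : Rmat (act A B ρ) 0 0 =
    (qf ρ (A 0) (B 0)).re + (qf ρ (A 0) (B 1)).re + (qf ρ (A 1) (B 0)).re
      + (qf ρ (A 1) (B 1)).re := by
  simp only [← act_diag]
  simp [Rmat, Matrix.trace, pauli, Fintype.sum_prod_type]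
  ring

lemma det_row (A : M2) (hA : A.det = 1) : ∃ r, 1/2 ≤ ‖A r‖^2 := by
  by_contra! hc
  have h0 := hc 0
  have h1 := hc 1
  have h : ‖A 0 0 * A 1 1 - A 0 1 * A 1 0‖ = 1 := by
    rw [← Matrix.det_fin_two, hA]; simp
  have h2 := norm_sub_le (A 0 0 * A 1 1) (A 0 1 * A 1 0)
  rw [norm_mul, norm_mul, h] at h2
  have e1 : ‖A 0 0‖ * ‖A 1 1‖ ≤ ‖A 0‖ * ‖A 1‖ := by
    gcongr <;> exact norm_le_pi_norm (_ : Fin 2 → ℂ) _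
  have e2 : ‖A 0 1‖ * ‖A 1 0‖ ≤ ‖A 0‖ * ‖A 1‖ := by
    gcongr <;> exact norm_le_pi_norm (_ : Fin 2 → ℂ) _
  nlinarith [sq_nonneg (‖A 0‖ - ‖A 1‖)]

lemma exists_min {ρ : M4} (h : ρ.PosSemidef)
    (hpos : ∀ a b : Fin 2 → ℂ, a ≠ 0 → b ≠ 0 → qf ρ a b ≠ 0) :
    ∃ A B : M2, A.det = 1 ∧ B.det = 1 ∧ ∀ C D : M2, C.det = 1 → D.det = 1 →
      Rmat (act A B ρ) 0 0 ≤ Rmat (act C D ρ) 0 0 := by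
  obtain ⟨c, hc, hq⟩ := qf_lower h hpos
  have hp : ∀ a b, 0 ≤ (qf ρ a b).re := fun a b => (Complex.le_def.1 (qf_nonneg h a b)).1
  have hf : ∀ (A B : M2) r s, c * (‖A r‖^2 * ‖B s‖^2) ≤ Rmat (act A B ρ) 0 0 := by
    intro A B r s
    rw [R00_eq]
    refine (hq _ _).trans ?_
    fin_cases r <;> fin_cases s <;> simp <;>
      linarith [hp (A 0) (B 0), hp (A 0) (B 1), hp (A 1) (B 0), hp (A 1) (B 1)]
  set f0 := Rmat ρ 0 0 with hf0
  have hbox : ∀ A B : M2, A.det = 1 → B.det = 1 → Rmat (act A B ρ) 0 0 ≤ f0 →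
      (∀ i j, ‖A i j‖ ≤ √(2 * f0 / c)) ∧ (∀ i j, ‖B i j‖ ≤ √(2 * f0 / c)) := by
    intro A B hA hB hle
    obtain ⟨r, hr⟩ := det_row A hA
    obtain ⟨s, hs⟩ := det_row B hB
    constructor
    · intro i j
      refine (norm_le_pi_norm (A i) j).trans (Real.le_sqrt_of_sq_le ?_)
      rw [le_div_iff₀ hc]
      have h1 := (hf A B i s).trans hle
      have h2 : c * (‖A i‖^2 * (1/2)) ≤ c * (‖A i‖^2 * ‖B s‖^2) := by gcongr
      linarith
    · intro i j
      refine (norm_le_pi_norm (B i) j).trans (Real.le_sqrt_of_sq_le ?_)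
      rw [le_div_iff₀ hc]
      have h1 := (hf A B r i).trans hle
      have h2 : c * ((1/2) * ‖B i‖^2) ≤ c * (‖A r‖^2 * ‖B i‖^2) := by gcongr
      linarith
  have hcl : IsClosed {A : M2 | A.det = 1} := isClosed_eq cont_det continuous_const
  have hK := (box_compact (√(2 * f0 / c))).inter_right hcl
  have h11 := hbox 1 1 (by simp) (by simp) (by rw [act_one])
  obtain ⟨⟨A, B⟩, ⟨hA, hB⟩, hm⟩ := (hK.prod hK).exists_isMinOn
    ⟨(1, 1), ⟨h11.1, by simp⟩, ⟨h11.2, by simp⟩⟩ (cont_R ρ 0 0).continuousOn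
  refine ⟨A, B, hA.2, hB.2, fun C D hC hD => ?_⟩
  by_cases hle : Rmat (act C D ρ) 0 0 ≤ f0
  · have := hbox C D hC hD hle
    exact hm (a := (C, D)) ⟨⟨this.1, hC⟩, ⟨this.2, hD⟩⟩
  · have h1 := hm (a := (1, 1)) ⟨⟨h11.1, by simp⟩, ⟨h11.2, by simp⟩⟩
    simp only [Set.mem_ofPred_eq, act_one] at h1
    linarith

lemma boost (k : Fin 4) (hk : k ≠ 0) (s : ℝ) : ∃ C : M2, C.det = 1 ∧ ∀ l,
    Lam C 0 l = (if l = 0 then 1 + 2 * s^2 else 0) + if l = k then 2 * (s * √(1 + s^2)) else 0 := by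
  have hr : √(1 + s^2) ^ 2 = 1 + s^2 := Real.sq_sqrt (by positivity)
  set c := √(1 + s^2)
  have hr' : (c : ℂ)^2 = 1 + (s : ℂ)^2 := by exact_mod_cast hr
  fin_cases k
  · simp at hk
  · refine ⟨!![(c : ℂ), s; s, c], by simp [Matrix.det_fin_two]; linear_combination hr', fun l => ?_⟩
    rw [Lam_explicit]
    fin_cases l <;> simp [LamE] <;> linarith
  · refine ⟨!![(c : ℂ), -s * Complex.I; s * Complex.I, c], ?_, fun l => ?_⟩
    · simp [Matrix.det_fin_two]; linear_combination hr' + s^2 * Complex.I_sq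
    rw [Lam_explicit]
    fin_cases l <;> simp [LamE] <;> linarith
  · refine ⟨!![((c + s : ℝ) : ℂ), 0; 0, ((c - s : ℝ) : ℂ)], ?_, fun l => ?_⟩
    · simp [Matrix.det_fin_two]; linear_combination hr'
    rw [Lam_explicit]
    fin_cases l <;> simp [LamE] <;> linarith

lemma crit2 (X Y : ℝ) (h : ∀ s : ℝ, 0 ≤ s^2 * X + s * √(1 + s^2) * Y) : Y = 0 := by
  by_contra hY
  have hY2 : 0 < Y^2 := by positivity
  have hX : 0 < |X| + 1 := by positivity
  have h1 := h (-(Y / (|X| + 1)))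
  have hr : 1 ≤ √(1 + (-(Y / (|X| + 1)))^2) := Real.one_le_sqrt.2 (by
    have := sq_nonneg (-(Y / (|X| + 1))); linarith)
  set w := √(1 + (-(Y / (|X| + 1)))^2)
  have h2 : (-(Y / (|X| + 1)))^2 * X + -(Y / (|X| + 1)) * w * Y
      = Y^2 / (|X| + 1)^2 * (X - w * (|X| + 1)) := by
    field_simp
    ring
  rw [h2] at h1
  have h3 : 0 < Y^2 / (|X| + 1)^2 := by positivity
  have h4 : X - w * (|X| + 1) < 0 := by nlinarith [le_abs_self X]
  nlinarith [mul_neg_of_pos_of_neg h3 h4]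

lemma good_pos {ρ : M4} (h : ρ.PosSemidef)
    (hpos : ∀ a b : Fin 2 → ℂ, a ≠ 0 → b ≠ 0 → qf ρ a b ≠ 0) : Good ρ := by
  obtain ⟨A, B, hA, hB, hm⟩ := exists_min h hpos
  have hm' : ∀ C D : M2, C.det = 1 → D.det = 1 → Rmat (act A B ρ) 0 0 ≤
      (Lam C * Rmat (act A B ρ) * (Lam D)ᵀ) 0 0 := by
    intro C D hC hD
    rw [← Rmat_act, act_act]
    exact hm _ _ (by simp [hC, hA]) (by simp [hD, hB])
  refine Good.of_act hA hB (good_svd (act_psd A B h) ?_ ?_)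
  · intro k hk
    refine crit2 (Rmat (act A B ρ) 0 0) _ fun s => ?_
    obtain ⟨C, hC, hL⟩ := boost k hk s
    have := hm' 1 C (by simp) hC
    rw [Lam_one, Matrix.one_mul, Matrix.mul_apply] at this
    simp only [Matrix.transpose_apply, hL, mul_add, Finset.sum_add_distrib, mul_ite, mul_zero,
      Finset.sum_ite_eq', Finset.mem_univ, if_true] at this
    linarith
  · intro k hk
    refine crit2 (Rmat (act A B ρ) 0 0) _ fun s => ?_
    obtain ⟨C, hC, hL⟩ := boost k hk s
    have := hm' C 1 hC (by simp)
    rw [Lam_one, Matrix.transpose_one, Matrix.mul_one, Matrix.mul_apply] at this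
    simp only [hL, add_mul, Finset.sum_add_distrib, ite_mul, zero_mul,
      Finset.sum_ite_eq', Finset.mem_univ, if_true] at this
    linarith

lemma good_all {ρ : M4} (h : ρ.PosSemidef) : Good ρ := by
  by_cases hpos : ∀ a b : Fin 2 → ℂ, a ≠ 0 → b ≠ 0 → qf ρ a b ≠ 0
  · exact good_pos h hpos
  · push Not at hpos
    obtain ⟨a, b, ha, hb, hq⟩ := hpos
    exact good_null h a b ha hb hq

theorem lorentz_singular_value_decomposition
    (ρ : Matrix (Fin 2 × Fin 2) (Fin 2 × Fin 2) ℂ)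
    (hρ : ρ.PosSemidef) (htr : ρ.trace = 1) :
    ∃ (L1 L2 S : Matrix (Fin 4) (Fin 4) ℝ), LorentzPO L1 ∧ LorentzPO L2 ∧
      Rmat ρ = L1 * S * L2ᵀ ∧
      ((∃ s : Fin 4 → ℝ, S = Matrix.diagonal s ∧
          s 1 ≤ s 0 ∧ s 2 ≤ s 1 ∧ |s 3| ≤ s 2) ∨
       (∃ a b c d : ℝ,
          S = !![a, 0, 0, b; 0, d, 0, 0; 0, 0, d, 0; c, 0, 0, b + c - a] ∧
          ((b = a / 2 ∧ c = a / 2) ∨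
           (d = 0 ∧ c = 0 ∧ b = a) ∨
           (d = 0 ∧ b = 0 ∧ c = a) ∨
           (d = 0 ∧ a = b ∧ b = c)))) := by
  exact (good_all hρ).final
end
end

section
/- Suppose the real 4×4 matrix R has Lorentz singular values s0 ≥ s1 ≥ s2 ≥ |s3|. Then the infimum over all pairs of proper orthochronous Lorentz matrices L1, L2 of Tr(L1 · R · L2ᵀ · diag(1,1,1,0)) (i.e., of the sum of the first three diagonal entries of L1 R L2ᵀ) equals s0 − s1 − s2, and this infimum is attained. -/
open Matrix

noncomputable section

/-- `R` has Lorentz singular values `s 0 ≥ s 1 ≥ s 2 ≥ |s 3|`. -/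
def HasLSV (R : Matrix (Fin 4) (Fin 4) ℝ) (s : Fin 4 → ℝ) : Prop :=
  s 1 ≤ s 0 ∧ s 2 ≤ s 1 ∧ |s 3| ≤ s 2 ∧
  ∃ L1 L2 : Matrix (Fin 4) (Fin 4) ℝ, LorentzPO L1 ∧ LorentzPO L2 ∧
    R = L1 * Matrix.diagonal s * L2ᵀ

lemma eta_sq : η * η = 1 := by
  unfold η
  rw [Matrix.diagonal_mul_diagonal, ← Matrix.diagonal_one]
  congr 1
  ext i
  fin_cases i <;> simp

/-- The pseudo-orthogonality relation for the transpose. -/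
lemma lor_transpose {L : Matrix (Fin 4) (Fin 4) ℝ} (h : Lᵀ * η * L = η) : L * η * Lᵀ = η := by
  have h1 : (η * Lᵀ * η) * L = 1 := by
    rw [Matrix.mul_assoc η, Matrix.mul_assoc η, h, eta_sq]
  have h2 : L * (η * Lᵀ * η) = 1 := mul_eq_one_comm.mp h1
  calc L * η * Lᵀ = (L * (η * Lᵀ * η)) * η := by
        simp only [Matrix.mul_assoc, eta_sq, Matrix.mul_one]
    _ = η := by rw [h2, Matrix.one_mul]

/-- Rows of a Lorentz matrix are pseudo-orthonormal. -/
lemma lor_row {L : Matrix (Fin 4) (Fin 4) ℝ} (h : L * η * Lᵀ = η) (i j : Fin 4) :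
    L i 0 * L j 0 - L i 1 * L j 1 - L i 2 * L j 2 - L i 3 * L j 3 = η i j := by
  have := congrFun (congrFun h i) j
  rw [← this]
  simp [η, Matrix.mul_apply, Matrix.mul_diagonal, Fin.sum_univ_four]
  ring

lemma lor_col {L : Matrix (Fin 4) (Fin 4) ℝ} (h : Lᵀ * η * L = η) (i j : Fin 4) :
    L 0 i * L 0 j - L 1 i * L 1 j - L 2 i * L 2 j - L 3 i * L 3 j = η i j := by
  have := lor_row (L := Lᵀ) (by simpa using h) i j
  simpa using this

/-- Reversed Cauchy-Schwarz for future timelike unit vectors. -/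
lemma timelike_ineq {a b x1 x2 x3 y1 y2 y3 : ℝ} (ha : 1 ≤ a) (hb : 1 ≤ b)
    (hx : x1 ^ 2 + x2 ^ 2 + x3 ^ 2 ≤ a ^ 2 - 1) (hy : y1 ^ 2 + y2 ^ 2 + y3 ^ 2 ≤ b ^ 2 - 1) :
    1 ≤ a * b + (x1 * y1 + x2 * y2 + x3 * y3) := by
  have hcs : (x1 * y1 + x2 * y2 + x3 * y3) ^ 2 ≤
      (x1 ^ 2 + x2 ^ 2 + x3 ^ 2) * (y1 ^ 2 + y2 ^ 2 + y3 ^ 2) := by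
    nlinarith [sq_nonneg (x1 * y2 - x2 * y1), sq_nonneg (x1 * y3 - x3 * y1),
      sq_nonneg (x2 * y3 - x3 * y2)]
  have h2 : (x1 ^ 2 + x2 ^ 2 + x3 ^ 2) * (y1 ^ 2 + y2 ^ 2 + y3 ^ 2) ≤
      (a ^ 2 - 1) * (b ^ 2 - 1) :=
    mul_le_mul hx hy (by positivity) (le_trans (by positivity) hx)
  have h3 : (x1 * y1 + x2 * y2 + x3 * y3) ^ 2 ≤ (a * b - 1) ^ 2 := by
    nlinarith [sq_nonneg (a - b)]
  have h4 : 0 ≤ a * b - 1 := by nlinarith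
  have := abs_le_of_sq_le_sq' h3 h4
  linarith [this.1]

lemma null_ineq {a b x1 x2 y1 y2 : ℝ} (ha : 0 ≤ a) (hb : 0 ≤ b)
    (hx : x1 ^ 2 + x2 ^ 2 ≤ a ^ 2) (hy : y1 ^ 2 + y2 ^ 2 ≤ b ^ 2) :
    0 ≤ a * b + (x1 * y1 + x2 * y2) := by
  have hcs : (x1 * y1 + x2 * y2) ^ 2 ≤ (x1 ^ 2 + x2 ^ 2) * (y1 ^ 2 + y2 ^ 2) := by
    nlinarith [sq_nonneg (x1 * y2 - x2 * y1)]
  have h2 : (x1 ^ 2 + x2 ^ 2) * (y1 ^ 2 + y2 ^ 2) ≤ a ^ 2 * b ^ 2 :=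
    mul_le_mul hx hy (by positivity) (by positivity)
  have h3 : (x1 * y1 + x2 * y2) ^ 2 ≤ (a * b) ^ 2 := by nlinarith
  have := abs_le_of_sq_le_sq' h3 (mul_nonneg ha hb)
  linarith [this.1]

lemma lor_mul {A B : Matrix (Fin 4) (Fin 4) ℝ} (hA : LorentzPO A) (hB : LorentzPO B) :
    LorentzPO (A * B) := by
  obtain ⟨a1, a2, a3⟩ := hA
  obtain ⟨b1, b2, b3⟩ := hB
  refine ⟨?_, by rw [Matrix.det_mul, a2, b2, one_mul], ?_⟩
  · calc (A * B)ᵀ * η * (A * B) = Bᵀ * (Aᵀ * η * A) * B := by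
          simp only [Matrix.transpose_mul, Matrix.mul_assoc]
      _ = η := by rw [a1, b1]
  · have hr := lor_row (lor_transpose a1) 0 0
    have hc := lor_col b1 0 0
    simp [η] at hr hc
    have := timelike_ineq (x1 := A 0 1) (x2 := A 0 2) (x3 := A 0 3) (y1 := B 1 0) (y2 := B 2 0)
      (y3 := B 3 0) a3 b3 (by linarith) (by linarith)
    simp only [Matrix.mul_apply, Fin.sum_univ_four]
    linarith

lemma lor_inv {L : Matrix (Fin 4) (Fin 4) ℝ} (h : LorentzPO L) :
    LorentzPO (η * Lᵀ * η) ∧ (η * Lᵀ * η) * L = 1 := by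
  obtain ⟨h1, h2, h3⟩ := h
  have hd : η.det * η.det = 1 := by rw [← Matrix.det_mul, eta_sq, Matrix.det_one]
  have ht : ηᵀ = η := by simp [η]
  refine ⟨⟨?_, ?_, ?_⟩, ?_⟩
  · calc (η * Lᵀ * η)ᵀ * η * (η * Lᵀ * η) = η * L * (η * η) * η * Lᵀ * η := by
          simp only [Matrix.transpose_mul, Matrix.transpose_transpose, ht, Matrix.mul_assoc]
      _ = η * (L * η * Lᵀ) * η := by
          rw [eta_sq, Matrix.mul_one]; simp only [Matrix.mul_assoc]
      _ = η := by rw [lor_transpose h1, eta_sq, Matrix.one_mul]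
  · rw [Matrix.det_mul, Matrix.det_mul, Matrix.det_transpose, h2, mul_one, hd]
  · simpa [η, Matrix.mul_diagonal, Matrix.diagonal_mul] using h3
  · rw [Matrix.mul_assoc η, Matrix.mul_assoc η, h1, eta_sq]

/-- Diagonal entries of the rotation part of a Lorentz matrix are at least `-1`. -/
lemma rot_entry {g x m1 m2 m3 b1 b2 b3 : ℝ} (hg : 1 ≤ g)
    (hb : g ^ 2 - b1 ^ 2 - b2 ^ 2 - b3 ^ 2 = 1) (hm : x ^ 2 - m1 ^ 2 - m2 ^ 2 - m3 ^ 2 = -1)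
    (hbm : g * x - b1 * m1 - b2 * m2 - b3 * m3 = 0) :
    (m1 - x * b1 / (1 + g)) ^ 2 + (m2 - x * b2 / (1 + g)) ^ 2 + (m3 - x * b3 / (1 + g)) ^ 2
      = 1 := by
  have : (1 + g) ≠ 0 := by linarith
  field_simp
  linear_combination (-(1 + g) ^ 2) * hm + (2 * x * (1 + g)) * hbm - x ^ 2 * hb

/-- Orthochronous Lorentz matrices have `L₀₀ + L₁₁ + L₂₂ ≥ -1`. -/
lemma trace3_ge {L : Matrix (Fin 4) (Fin 4) ℝ} (h : L * η * Lᵀ = η) (h0 : 1 ≤ L 0 0) :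
    -1 ≤ L 0 0 + L 1 1 + L 2 2 := by
  have hc := lor_col (L := L) (by simpa using lor_transpose (L := Lᵀ) (by simpa using h)) 0 0
  have h00 := lor_row h 0 0
  have h01 := lor_row h 0 1
  have h02 := lor_row h 0 2
  have h11 := lor_row h 1 1
  have h22 := lor_row h 2 2
  simp [η] at hc h00 h01 h02 h11 h22
  have e1 := rot_entry (x := L 1 0) (m1 := L 1 1) (m2 := L 1 2) (m3 := L 1 3) (b1 := L 0 1)
    (b2 := L 0 2) (b3 := L 0 3) h0 (by linarith) (by linarith) (by linarith)
  have e2 := rot_entry (x := L 2 0) (m1 := L 2 1) (m2 := L 2 2) (m3 := L 2 3) (b1 := L 0 1)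
    (b2 := L 0 2) (b3 := L 0 3) h0 (by linarith) (by linarith) (by linarith)
  have o1 : -1 ≤ L 1 1 - L 1 0 * L 0 1 / (1 + L 0 0) := by
    refine (abs_le_of_sq_le_sq' (b := 1) ?_ zero_le_one).1
    linarith [sq_nonneg (L 1 2 - L 1 0 * L 0 2 / (1 + L 0 0)),
      sq_nonneg (L 1 3 - L 1 0 * L 0 3 / (1 + L 0 0))]
  have o2 : -1 ≤ L 2 2 - L 2 0 * L 0 2 / (1 + L 0 0) := by
    refine (abs_le_of_sq_le_sq' (b := 1) ?_ zero_le_one).1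
    linarith [sq_nonneg (L 2 1 - L 2 0 * L 0 1 / (1 + L 0 0)),
      sq_nonneg (L 2 3 - L 2 0 * L 0 3 / (1 + L 0 0))]
  have hp : 0 < 1 + L 0 0 := by linarith
  have o3 : 0 ≤ (L 0 0 - 1) + (L 1 0 * L 0 1 / (1 + L 0 0) + L 2 0 * L 0 2 / (1 + L 0 0)) := by
    have : (L 0 0 - 1) + (L 1 0 * L 0 1 / (1 + L 0 0) + L 2 0 * L 0 2 / (1 + L 0 0))
        = (L 0 0 ^ 2 - 1 + L 1 0 * L 0 1 + L 2 0 * L 0 2) / (1 + L 0 0) := by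
      field_simp
      ring
    rw [this]
    apply div_nonneg _ hp.le
    nlinarith [sq_nonneg (L 1 0 + L 0 1), sq_nonneg (L 2 0 + L 0 2), sq_nonneg (L 3 0),
      sq_nonneg (L 0 3)]
  linarith

/-- The bound for the extreme rays `(1,1,1,±1)`. -/
lemma ray3 {A B : Matrix (Fin 4) (Fin 4) ℝ} (hA : LorentzPO A) (hB : LorentzPO B) (e : ℝ)
    (he : e * e = 1) :
    -1 ≤ (A * Matrix.diagonal ![1, 1, 1, e] * Bᵀ) 0 0
      + (A * Matrix.diagonal ![1, 1, 1, e] * Bᵀ) 1 1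
      + (A * Matrix.diagonal ![1, 1, 1, e] * Bᵀ) 2 2 := by
  obtain ⟨a1, a2, a3⟩ := hA
  obtain ⟨b1, b2, b3⟩ := hB
  apply trace3_ge
  · have hD : Matrix.diagonal ![1, 1, 1, e] * η * Matrix.diagonal ![1, 1, 1, e] = η := by
      unfold η
      rw [Matrix.diagonal_mul_diagonal, Matrix.diagonal_mul_diagonal]
      congr 1
      ext i
      fin_cases i <;> simp [he]
    calc _ = A * (Matrix.diagonal ![1, 1, 1, e] * (Bᵀ * η * B) * Matrix.diagonal ![1, 1, 1, e])
          * Aᵀ := by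
          simp only [Matrix.transpose_mul, Matrix.transpose_transpose, Matrix.diagonal_transpose,
            Matrix.mul_assoc]
      _ = η := by rw [b1, hD, lor_transpose a1]
  · have hr := lor_row (lor_transpose a1) 0 0
    have hc := lor_row (lor_transpose b1) 0 0
    simp [η] at hr hc
    have h3 : (A 0 3 * e) ^ 2 = A 0 3 * A 0 3 := by
      linear_combination (A 0 3) ^ 2 * he
    have := timelike_ineq (x1 := A 0 1) (x2 := A 0 2) (x3 := A 0 3 * e) (y1 := B 0 1)
      (y2 := B 0 2) (y3 := B 0 3) a3 b3 (by linarith) (by linarith)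
    simp [Matrix.mul_apply, Matrix.mul_diagonal, Fin.sum_univ_four]
    linarith

lemma ray1 {A B : Matrix (Fin 4) (Fin 4) ℝ} (hA : LorentzPO A) (hB : LorentzPO B) :
    1 ≤ A 0 0 * B 0 0 + A 1 0 * B 1 0 + A 2 0 * B 2 0 := by
  obtain ⟨a1, a2, a3⟩ := hA
  obtain ⟨b1, b2, b3⟩ := hB
  have hr := lor_col a1 0 0
  have hc := lor_col b1 0 0
  simp [η] at hr hc
  have := timelike_ineq (x1 := A 1 0) (x2 := A 2 0) (x3 := 0) (y1 := B 1 0)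
      (y2 := B 2 0) (y3 := 0) a3 b3 (by nlinarith [sq_nonneg (A 3 0)])
      (by nlinarith [sq_nonneg (B 3 0)])
  linarith

lemma abs_col {A : Matrix (Fin 4) (Fin 4) ℝ} (hA : LorentzPO A) :
    0 ≤ A 0 0 - A 0 1 ∧ 0 ≤ A 0 0 + A 0 1 := by
  obtain ⟨a1, a2, a3⟩ := hA
  have hr := lor_row (lor_transpose a1) 0 0
  simp [η] at hr
  have : (A 0 1) ^ 2 ≤ (A 0 0) ^ 2 := by
    nlinarith [sq_nonneg (A 0 2), sq_nonneg (A 0 3)]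
  have := abs_le_of_sq_le_sq' this (by linarith)
  constructor <;> linarith [this.1, this.2]

lemma ray2 {A B : Matrix (Fin 4) (Fin 4) ℝ} (hA : LorentzPO A) (hB : LorentzPO B) :
    0 ≤ A 0 0 * B 0 0 + A 1 0 * B 1 0 + A 2 0 * B 2 0
      + (A 0 1 * B 0 1 + A 1 1 * B 1 1 + A 2 1 * B 2 1) := by
  obtain ⟨pa, qa⟩ := abs_col hA
  obtain ⟨pb, qb⟩ := abs_col hB
  obtain ⟨a1, a2, a3⟩ := hA
  obtain ⟨b1, b2, b3⟩ := hB
  have a00 := lor_col a1 0 0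
  have a01 := lor_col a1 0 1
  have a11 := lor_col a1 1 1
  have b00 := lor_col b1 0 0
  have b01 := lor_col b1 0 1
  have b11 := lor_col b1 1 1
  simp [η] at a00 a01 a11 b00 b01 b11
  have m := null_ineq (x1 := A 1 0 - A 1 1) (x2 := A 2 0 - A 2 1) (y1 := B 1 0 - B 1 1)
    (y2 := B 2 0 - B 2 1) pa pb (by linarith [sq_nonneg (A 3 0 - A 3 1)])
    (by linarith [sq_nonneg (B 3 0 - B 3 1)])
  have p := null_ineq (x1 := A 1 0 + A 1 1) (x2 := A 2 0 + A 2 1) (y1 := B 1 0 + B 1 1)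
    (y2 := B 2 0 + B 2 1) qa qb (by linarith [sq_nonneg (A 3 0 + A 3 1)])
    (by linarith [sq_nonneg (B 3 0 + B 3 1)])
  linarith

lemma lower_bound {A B : Matrix (Fin 4) (Fin 4) ℝ} (hA : LorentzPO A) (hB : LorentzPO B)
    (s : Fin 4 → ℝ) (h1 : s 1 ≤ s 0) (h2 : s 2 ≤ s 1) (h3 : |s 3| ≤ s 2) :
    s 0 - s 1 - s 2 ≤ (A * Matrix.diagonal s * Bᵀ * Matrix.diagonal ![1, 1, 1, 0]).trace := by
  have r1 := ray1 hA hB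
  have r2 := ray2 hA hB
  have r3 := ray3 hA hB 1 (by norm_num)
  have r4 := ray3 hA hB (-1) (by norm_num)
  obtain ⟨u, v⟩ := abs_le.mp h3
  have k1 := mul_nonneg (sub_nonneg.2 h1) (sub_nonneg.2 r1)
  have k2 := mul_nonneg (sub_nonneg.2 h2) r2
  have k3 := mul_nonneg (show 0 ≤ (s 2 + s 3) / 2 by linarith) (sub_nonneg.2 r3)
  have k4 := mul_nonneg (show 0 ≤ (s 2 - s 3) / 2 by linarith) (sub_nonneg.2 r4)
  simp [Matrix.mul_apply, Matrix.mul_diagonal, Fin.sum_univ_four] at k1 k2 k3 k4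
  simp [Matrix.trace, Matrix.mul_apply, Matrix.mul_diagonal, Fin.sum_univ_four]
  linarith

lemma flip_lor : LorentzPO (Matrix.diagonal ![1, -1, -1, 1]) := by
  refine ⟨?_, ?_, ?_⟩
  · unfold η
    rw [Matrix.diagonal_transpose, Matrix.diagonal_mul_diagonal, Matrix.diagonal_mul_diagonal]
    congr 1
    ext i
    fin_cases i <;> simp
  · simp [Matrix.det_diagonal, Fin.prod_univ_four]
  · simp

theorem lsv_variational_s0_sub_s1_sub_s2 (R : Matrix (Fin 4) (Fin 4) ℝ) (s : Fin 4 → ℝ)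
    (h : HasLSV R s) :
    IsLeast {x : ℝ | ∃ L1 L2 : Matrix (Fin 4) (Fin 4) ℝ,
        LorentzPO L1 ∧ LorentzPO L2 ∧
        x = (L1 * R * L2ᵀ * Matrix.diagonal ![1, 1, 1, 0]).trace}
      (s 0 - s 1 - s 2) := by
  obtain ⟨h1, h2, h3, M1, M2, hM1, hM2, rfl⟩ := h
  constructor
  · obtain ⟨i1, j1⟩ := lor_inv hM1
    obtain ⟨i2, j2⟩ := lor_inv hM2
    generalize η * M1ᵀ * η = N1 at i1 j1
    generalize η * M2ᵀ * η = N2 at i2 j2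
    refine ⟨N1, Matrix.diagonal ![1, -1, -1, 1] * N2, i1, lor_mul flip_lor i2, ?_⟩
    have : N1 * (M1 * Matrix.diagonal s * M2ᵀ) * (Matrix.diagonal ![1, -1, -1, 1] * N2)ᵀ
        = (N1 * M1) * Matrix.diagonal s * (N2 * M2)ᵀ * Matrix.diagonal ![1, -1, -1, 1] := by
      simp only [Matrix.transpose_mul, Matrix.diagonal_transpose, Matrix.mul_assoc]
    rw [this, j1, j2]
    simp [Matrix.trace, Fin.sum_univ_four]
    ring
  · rintro x ⟨L1, L2, hL1, hL2, rfl⟩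
    have := lower_bound (lor_mul hL1 hM1) (lor_mul hL2 hM2) s h1 h2 h3
    have e : L1 * (M1 * Matrix.diagonal s * M2ᵀ) * L2ᵀ
        = (L1 * M1) * Matrix.diagonal s * (L2 * M2)ᵀ := by
      simp only [Matrix.transpose_mul, Matrix.mul_assoc]
    rw [e]
    exact this
end
end

section
/- Let ρ be a two-qubit density matrix whose R-matrix has Lorentz singular values s0 ≥ s1 ≥ s2 ≥ |s3|. Then the multiset of eigenvalues (with algebraic multiplicity) of the 4×4 matrix (σ2⊗σ2) · ρᵀ · (σ2⊗σ2) · ρ equals {λ1², λ2², λ3², λ4²}, where λ1 = (s0+s1+s2−s3)/4, λ2 = (s0+s1−s2+s3)/4, λ3 = (s0−s1+s2+s3)/4, λ4 = (s0−s1−s2−s3)/4. -/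
open Matrix Kronecker ComplexOrder

noncomputable section

/-- The Wootters matrix `(σ₂⊗σ₂) ρᵀ (σ₂⊗σ₂) ρ`. -/
def woottersMat (ρ : Matrix (Fin 2 × Fin 2) (Fin 2 × Fin 2) ℂ) :
    Matrix (Fin 2 × Fin 2) (Fin 2 × Fin 2) ℂ :=
  (pauli 2 ⊗ₖ pauli 2) * ρᵀ * (pauli 2 ⊗ₖ pauli 2) * ρ


/-- Matrix product of a quadruple of mutually orthogonal `2×2` matrices (for the determinant form). -/
lemma quad_prod (p q r t : Fin 4 → ℂ)
    (h : ∀ a b, a ≠ b → p a * t b + t a * p b - q a * r b - r a * q b = 0) :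
    (!![t 0, -q 0; -r 0, p 0] * !![p 2, q 2; r 2, t 2] *
      (!![t 1, -q 1; -r 1, p 1] * !![p 3, q 3; r 3, t 3]) : Matrix (Fin 2) (Fin 2) ℂ)
      = (-(Matrix.of ![p, q, r, t]).det / 4) • 1 := by
  have hab := h 0 2 (by decide)
  have hac := h 0 1 (by decide)
  have had := h 0 3 (by decide)
  have hbc := h 2 1 (by decide)
  have hbd := h 2 3 (by decide)
  have hcd := h 1 3 (by decide)
  have hdet : (Matrix.of ![p, q, r, t]).det =
      p 0 * (q 1 * (r 2 * t 3 - r 3 * t 2) - q 2 * (r 1 * t 3 - r 3 * t 1)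
        + q 3 * (r 1 * t 2 - r 2 * t 1))
      - p 1 * (q 0 * (r 2 * t 3 - r 3 * t 2) - q 2 * (r 0 * t 3 - r 3 * t 0)
        + q 3 * (r 0 * t 2 - r 2 * t 0))
      + p 2 * (q 0 * (r 1 * t 3 - r 3 * t 1) - q 1 * (r 0 * t 3 - r 3 * t 0)
        + q 3 * (r 0 * t 1 - r 1 * t 0))
      - p 3 * (q 0 * (r 1 * t 2 - r 2 * t 1) - q 1 * (r 0 * t 2 - r 2 * t 0)
        + q 2 * (r 0 * t 1 - r 1 * t 0)) := by
    simp [Matrix.det_succ_row_zero, Fin.sum_univ_succ, Fin.succAbove]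
    ring
  rw [hdet]
  have e (a b : Fin 4) : (!![t a, -q a; -r a, p a] * !![p b, q b; r b, t b]
      : Matrix (Fin 2) (Fin 2) ℂ) =
      !![t a * p b - q a * r b, t a * q b - q a * t b;
         p a * r b - r a * p b, p a * t b - r a * q b] := by
    ext i j; fin_cases i <;> fin_cases j <;> simp <;> ring
  rw [e, e]
  ext i j
  fin_cases i <;> fin_cases j <;> simp
  · linear_combination (1/2) * ((t 1 * p 3 - q 1 * r 3) * hab - (t 2 * p 3 - q 2 * r 3) * hac
      + (t 2 * p 1 - q 2 * r 1) * had + (t 0 * p 3 - q 0 * r 3) * hbc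
      - (t 0 * p 1 - q 0 * r 1) * hbd + (t 0 * p 2 - q 0 * r 2) * hcd)
      - (1/4) * ((p 1 * t 3 + t 1 * p 3 - q 1 * r 3 - r 1 * q 3) * hab
      - (p 2 * t 3 + t 2 * p 3 - q 2 * r 3 - r 2 * q 3) * hac
      + (p 2 * t 1 + t 2 * p 1 - q 2 * r 1 - r 2 * q 1) * had)
  · linear_combination (1/2) * ((t 1 * q 3 - q 1 * t 3) * hab - (t 2 * q 3 - q 2 * t 3) * hac
      + (t 2 * q 1 - q 2 * t 1) * had + (t 0 * q 3 - q 0 * t 3) * hbc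
      - (t 0 * q 1 - q 0 * t 1) * hbd + (t 0 * q 2 - q 0 * t 2) * hcd)
  · linear_combination (1/2) * ((p 1 * r 3 - r 1 * p 3) * hab - (p 2 * r 3 - r 2 * p 3) * hac
      + (p 2 * r 1 - r 2 * p 1) * had + (p 0 * r 3 - r 0 * p 3) * hbc
      - (p 0 * r 1 - r 0 * p 1) * hbd + (p 0 * r 2 - r 0 * p 2) * hcd)
  · linear_combination (1/2) * ((p 1 * t 3 - r 1 * q 3) * hab - (p 2 * t 3 - r 2 * q 3) * hac
      + (p 2 * t 1 - r 2 * q 1) * had + (p 0 * t 3 - r 0 * q 3) * hbc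
      - (p 0 * t 1 - r 0 * q 1) * hbd + (p 0 * t 2 - r 0 * q 2) * hcd)
      - (1/4) * ((p 1 * t 3 + t 1 * p 3 - q 1 * r 3 - r 1 * q 3) * hab
      - (p 2 * t 3 + t 2 * p 3 - q 2 * r 3 - r 2 * q 3) * hac
      + (p 2 * t 1 + t 2 * p 1 - q 2 * r 1 - r 2 * q 1) * had)

/-- Matrices satisfying the Pauli relations are simultaneously conjugate to the Pauli matrices. -/
lemma pauli_conj (τ1 τ2 τ3 : Matrix (Fin 2) (Fin 2) ℂ) (h1 : τ1 * τ1 = 1) (h3 : τ3 * τ3 = 1)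
    (h13 : τ1 * τ3 = -(τ3 * τ1)) (h2 : τ2 = Complex.I • (τ1 * τ3)) :
    ∃ C : Matrix (Fin 2) (Fin 2) ℂ, C.det ≠ 0 ∧ τ1 * C = C * pauli 1 ∧ τ2 * C = C * pauli 2 ∧
      τ3 * C = C * pauli 3 := by
  obtain ⟨u, hu0, hu⟩ : ∃ u : Fin 2 → ℂ, u ≠ 0 ∧ τ3 *ᵥ u = u := by
    by_contra hcon
    push Not at hcon
    have hz : 1 + τ3 = 0 := by
      ext i j
      by_contra hij
      refine hcon ((1 + τ3) *ᵥ (Pi.single j 1)) ?_ ?_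
      · intro h0
        apply hij
        have := congrFun h0 i
        simpa [Matrix.mulVec_single] using this
      · rw [Matrix.mulVec_mulVec, mul_add, h3, mul_one, add_comm]
    have h3' : τ3 = -1 := (neg_eq_of_add_eq_zero_right hz).symm
    rw [h3'] at h13
    have h0 : τ1 = 0 := by
      have : τ1 + τ1 = 0 := by
        have h13' : -τ1 = τ1 := by simpa using h13
        nth_rewrite 1 [← h13']
        simp
      ext i j
      have := congrFun (congrFun this i) j
      simpa using this
    rw [h0] at h1
    simp at h1
  set w := τ1 *ᵥ u with hw
  have hw1 : τ1 *ᵥ w = u := by rw [hw, Matrix.mulVec_mulVec, h1, Matrix.one_mulVec]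
  have hw3 : τ3 *ᵥ w = -w := by
    have : τ3 * τ1 = -(τ1 * τ3) := by rw [h13, neg_neg]
    rw [hw, Matrix.mulVec_mulVec, this, Matrix.neg_mulVec, ← Matrix.mulVec_mulVec, hu]
  have hu2 : τ2 *ᵥ u = Complex.I • w := by
    rw [h2, Matrix.smul_mulVec, ← Matrix.mulVec_mulVec, hu]
  have hw2 : τ2 *ᵥ w = -(Complex.I • u) := by
    rw [h2, Matrix.smul_mulVec, ← Matrix.mulVec_mulVec, hw3, Matrix.mulVec_neg, hw1, smul_neg]
  have hmul (τ : Matrix (Fin 2) (Fin 2) ℂ) (i : Fin 2) (v : Fin 2 → ℂ) :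
      (τ *ᵥ v) i = τ i 0 * v 0 + τ i 1 * v 1 := by
    simp [Matrix.mulVec, dotProduct, Fin.sum_univ_two]
  refine ⟨!![u 0, w 0; u 1, w 1], ?_, ?_, ?_, ?_⟩
  · intro hd
    rw [Matrix.det_fin_two_of] at hd
    have a0 := congrFun hw3 0
    have a1 := congrFun hw3 1
    have b0 := congrFun hu 0
    have b1 := congrFun hu 1
    simp only [hmul, Pi.neg_apply] at a0 a1 b0 b1
    have hw0 : w ≠ 0 := by
      intro h0
      rw [h0, Matrix.mulVec_zero] at hw1
      exact hu0 hw1.symm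
    have c00 : u 0 * w 0 = 0 := by
      linear_combination (1/2) * w 0 * (-b0) + (1/2) * u 0 * a0 + (1/2) * τ3 0 1 * (-hd)
    have c11 : u 1 * w 1 = 0 := by
      linear_combination (1/2) * w 1 * (-b1) + (1/2) * u 1 * a1 + (1/2) * τ3 1 0 * hd
    have c01 : u 0 * w 1 = 0 := by
      linear_combination (1/2) * (-w 1 * b0 + u 1 * a0 + τ3 0 0 * hd + hd)
    have c10 : u 1 * w 0 = 0 := by linear_combination c01 - hd
    apply hu0
    ext i
    by_contra hi
    apply hw0
    ext j
    fin_cases i <;> fin_cases j <;> simp_all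
  · ext i j
    have a1 := congrFun hw.symm i
    have a2 := congrFun hw1 i
    simp only [hmul] at a1 a2
    fin_cases i <;> fin_cases j <;> simpa [pauli, Matrix.mul_apply, Fin.sum_univ_two]
  · ext i j
    have a1 := congrFun hu2 i
    have a2 := congrFun hw2 i
    simp only [hmul, Pi.neg_apply, Pi.smul_apply, smul_eq_mul] at a1 a2
    fin_cases i <;> fin_cases j <;>
      simpa [pauli, Matrix.mul_apply, Fin.sum_univ_two, mul_comm (_ : ℂ) Complex.I]
  · ext i j
    have a1 := congrFun hu i
    have a2 := congrFun hw3 i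
    simp only [hmul, Pi.neg_apply] at a1 a2
    fin_cases i <;> fin_cases j <;> simpa [pauli, Matrix.mul_apply, Fin.sum_univ_two]

/-- Lift of a Lorentz matrix to a two-sided action on `2×2` matrices. -/
lemma lorentz_lift (L : Matrix (Fin 4) (Fin 4) ℝ) (hL : LorentzPO L) :
    ∃ A B : Matrix (Fin 2) (Fin 2) ℂ, A.det * B.det = 1 ∧
      ∀ k, ∑ i, (L i k : ℂ) • pauli i = A * pauli k * B := by
  obtain ⟨hη, hdet, -⟩ := hL
  set p : Fin 4 → ℂ := fun k => L 0 k + L 3 k with hp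
  set q : Fin 4 → ℂ := fun k => L 1 k - Complex.I * L 2 k with hq
  set r : Fin 4 → ℂ := fun k => L 1 k + Complex.I * L 2 k with hr
  set t : Fin 4 → ℂ := fun k => L 0 k - L 3 k with ht
  set M : Fin 4 → Matrix (Fin 2) (Fin 2) ℂ := fun k => !![p k, q k; r k, t k] with hM
  set N : Fin 4 → Matrix (Fin 2) (Fin 2) ℂ := fun k => !![t k, -q k; -r k, p k] with hN
  have hσ (k) : ∑ i, (L i k : ℂ) • pauli i = M k := by
    ext i j
    fin_cases i <;> fin_cases j <;>
      simp [pauli, Fin.sum_univ_four, hM, hp, hq, hr, ht] <;> ring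
  have hg (a b : Fin 4) : p a * t b + t a * p b - q a * r b - r a * q b = 2 * (η a b : ℝ) := by
    have h1 : (η a b : ℝ) = L 0 a * L 0 b - L 1 a * L 1 b - L 2 a * L 2 b - L 3 a * L 3 b := by
      rw [← hη]
      simp [η, Matrix.mul_apply, Fin.sum_univ_four, Matrix.diagonal]
      ring
    rw [h1]
    simp only [hp, hq, hr, ht]
    push_cast
    linear_combination 2 * (L 2 a : ℂ) * L 2 b * Complex.I_sq
  have hND : (Matrix.of ![p, q, r, t]).det = -4 * Complex.I := by
    have : (Matrix.of ![p, q, r, t]) =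
        !![1, 0, 0, 1; 0, 1, -Complex.I, 0; 0, 1, Complex.I, 0; 1, 0, 0, -1] *
          L.map Complex.ofReal := by
      ext i j
      fin_cases i <;>
        simp [hp, hq, hr, ht, Matrix.mul_apply, Fin.sum_univ_four] <;> ring
    have hdL : (L.map Complex.ofReal).det = 1 := by
      have := RingHom.map_det Complex.ofRealHom L
      rw [hdet] at this
      rw [map_one] at this
      exact this.symm
    rw [this, Matrix.det_mul, hdL]
    simp [Matrix.det_succ_row_zero, Fin.sum_univ_succ, Fin.succAbove]
    ring
  have hquad : N 0 * M 2 * (N 1 * M 3) = Complex.I • 1 := by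
    have := quad_prod p q r t (fun a b hab => by rw [hg, η, Matrix.diagonal_apply_ne _ hab]; simp)
    rw [hND] at this
    rw [show Complex.I = -(-4 * Complex.I) / 4 by ring]
    exact this
  have hcl (a b : Fin 4) : N a * M b + N b * M a = (2 * (η a b : ℂ)) • 1 := by
    rw [← hg]
    ext i j
    fin_cases i <;> fin_cases j <;> simp [hM, hN] <;> ring
  have hMN (a : Fin 4) : M a * N a = (η a a : ℂ) • 1 := by
    have := hg a a
    ext i j
    fin_cases i <;> fin_cases j <;> simp [hM, hN] <;>
      first | ring1 | linear_combination (1/2) * this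
  have hNM (a : Fin 4) : N a * M a = (η a a : ℂ) • 1 := by
    have := hg a a
    ext i j
    fin_cases i <;> fin_cases j <;> simp [hM, hN] <;>
      first | ring1 | linear_combination (1/2) * this
  have e0 : η 0 0 = 1 := by simp [η]
  have e1 : η 1 1 = -1 := by simp [η]
  have e3 : η 3 3 = -1 := by simp [η, Matrix.diagonal]
  have hanti (a b : Fin 4) (hab : a ≠ b) : N a * M b = -(N b * M a) := by
    have := hcl a b
    rw [η, Matrix.diagonal_apply_ne _ hab] at this
    exact eq_neg_of_add_eq_zero_left (by simpa using this)
  have m0 : M 0 * N 0 = 1 := by simpa [e0] using hMN 0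
  have hprod (a b : Fin 4) (ha : 0 ≠ a) : N 0 * M a * (N 0 * M b) = -(N a * M b) := by
    rw [hanti 0 a ha, neg_mul, mul_assoc, ← mul_assoc (M 0), m0, one_mul]
  have t1 : N 0 * M 1 * (N 0 * M 1) = 1 := by
    rw [hprod _ _ (by decide), hNM, e1]; simp
  have t3 : N 0 * M 3 * (N 0 * M 3) = 1 := by
    rw [hprod _ _ (by decide), hNM, e3]; simp
  have t13 : N 0 * M 1 * (N 0 * M 3) = -(N 0 * M 3 * (N 0 * M 1)) := by
    rw [hprod _ _ (by decide), hprod _ _ (by decide), hanti 1 3 (by decide)]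
  have t2 : N 0 * M 2 = Complex.I • (N 0 * M 1 * (N 0 * M 3)) := by
    have hsq : (N 0 * M 1 * (N 0 * M 3)) * (N 0 * M 1 * (N 0 * M 3)) = -1 := by
      nth_rewrite 1 [t13]
      rw [neg_mul, mul_assoc, ← mul_assoc (N 0 * M 1) (N 0 * M 1), t1, one_mul, t3]
    have h13 : N 1 * M 3 = -(N 0 * M 1 * (N 0 * M 3)) := by
      rw [hprod _ _ (by decide), neg_neg]
    rw [h13] at hquad
    have := congrArg (· * (N 0 * M 1 * (N 0 * M 3))) hquad
    simp only [mul_neg, neg_mul] at this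
    rw [mul_assoc (N 0 * M 2), hsq] at this
    simpa using this
  obtain ⟨C, hC, c1, c2, c3⟩ := pauli_conj _ _ _ t1 t3 t13 t2
  have hCu : IsUnit C.det := isUnit_iff_ne_zero.mpr hC
  have hCC : C * C⁻¹ = 1 := Matrix.mul_nonsing_inv C hCu
  have key (k : Fin 4) (hk : N 0 * M k * C = C * pauli k) :
      M k = M 0 * C * pauli k * C⁻¹ := by
    rw [mul_assoc (M 0), ← hk, mul_assoc (M 0), mul_assoc (N 0 * M k), hCC, mul_one, ← mul_assoc,
      m0, one_mul]
  refine ⟨M 0 * C, C⁻¹, ?_, ?_⟩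
  · rw [← Matrix.det_mul, mul_assoc, hCC, mul_one]
    have := hg 0 0
    rw [e0, Complex.ofReal_one] at this
    simp only [hM, Matrix.det_fin_two_of]
    linear_combination (1/2) * this
  · intro k
    rw [hσ]
    apply key
    fin_cases k
    · have : N 0 * M 0 = 1 := by simpa [e0] using hNM 0
      simp [this, pauli]
    · exact c1
    · exact c2
    · exact c3

lemma pauli_flip (A : Matrix (Fin 2) (Fin 2) ℂ) : pauli 2 * Aᵀ * pauli 2 = A.adjugate := by
  rw [Matrix.adjugate_fin_two]
  ext i j
  fin_cases i <;> fin_cases j <;>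
    simp [pauli, Matrix.mul_apply, Fin.sum_univ_two, Matrix.vecMul, dotProduct] <;>
    ring_nf <;> simp

lemma pauli2_sq : pauli 2 * pauli 2 = 1 := by
  ext i j
  fin_cases i <;> fin_cases j <;> simp [pauli, Matrix.mul_apply, Fin.sum_univ_two]

lemma pauli_herm_s12 (k : Fin 4) : (pauli k)ᴴ = pauli k := by
  ext i j
  fin_cases k <;> fin_cases i <;> fin_cases j <;> simp [pauli]

/-- The Bell-diagonal normal form. -/
def rho0 (s : Fin 4 → ℝ) : Matrix (Fin 2 × Fin 2) (Fin 2 × Fin 2) ℂ :=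
  (1/4 : ℂ) • ∑ k, (s k : ℂ) • (pauli k ⊗ₖ pauli k)

lemma rho0_flip (s : Fin 4 → ℝ) :
    (pauli 2 ⊗ₖ pauli 2) * (rho0 s)ᵀ * (pauli 2 ⊗ₖ pauli 2) = rho0 s := by
  have h (k : Fin 4) : (pauli 2 ⊗ₖ pauli 2) * (pauli k ⊗ₖ pauli k)ᵀ * (pauli 2 ⊗ₖ pauli 2)
      = pauli k ⊗ₖ pauli k := by
    rw [← Matrix.kroneckerMap_transpose, ← Matrix.mul_kronecker_mul, ← Matrix.mul_kronecker_mul,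
      pauli_flip, Matrix.adjugate_fin_two]
    ext ⟨i, i'⟩ ⟨j, j'⟩
    fin_cases k <;> fin_cases i <;> fin_cases j <;> fin_cases i' <;> fin_cases j' <;> simp [pauli]
  simp only [rho0, Matrix.transpose_smul, Matrix.transpose_sum, Finset.mul_sum, Finset.sum_mul,
    Matrix.mul_smul, Matrix.smul_mul, h]

/-- Bell basis. -/
def bellV : Matrix (Fin 2 × Fin 2) (Fin 2 × Fin 2) ℂ :=
  Matrix.of fun i j => if i.1 + i.2 = j.1 + j.2 then (if i.1 = 1 ∧ j.1 = 1 then -1 else 1) else 0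

lemma bellV_sq : bellVᵀ * bellV = (2 : ℂ) • 1 := by
  ext ⟨i, i'⟩ ⟨j, j'⟩
  fin_cases i <;> fin_cases j <;> fin_cases i' <;> fin_cases j' <;>
    simp [bellV, Matrix.mul_apply, Fintype.sum_prod_type] <;> norm_num

def bellD (s : Fin 4 → ℝ) : Fin 2 × Fin 2 → ℂ := fun i =>
  (![![(s 0 + s 1 - s 2 + s 3) / 4, (s 0 + s 1 + s 2 - s 3) / 4],
    ![(s 0 - s 1 - s 2 - s 3) / 4, (s 0 - s 1 + s 2 + s 3) / 4]] i.1 i.2 : ℝ)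

lemma rho0_eq (s : Fin 4 → ℝ) :
    rho0 s = (1/2 : ℂ) • (bellV * Matrix.diagonal (bellD s) * bellVᵀ) := by
  ext ⟨i, i'⟩ ⟨j, j'⟩
  fin_cases i <;> fin_cases j <;> fin_cases i' <;> fin_cases j' <;>
    simp [rho0, bellV, bellD, pauli, Matrix.mul_apply, Fintype.sum_prod_type,
      Matrix.diagonal_apply, Fin.sum_univ_four] <;> ring

lemma rho0_sq_charpoly (s : Fin 4 → ℝ) :
    (rho0 s * rho0 s).charpoly = ∏ i, (Polynomial.X - Polynomial.C (bellD s i ^ 2)) := by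
  have h : rho0 s * rho0 s = bellV * ((1/2 : ℂ) • (Matrix.diagonal (fun i => bellD s i ^ 2)
      * bellVᵀ)) := by
    rw [rho0_eq]
    simp only [Matrix.smul_mul, Matrix.mul_smul, smul_smul]
    have : bellV * Matrix.diagonal (bellD s) * bellVᵀ * (bellV * Matrix.diagonal (bellD s) * bellVᵀ)
      = bellV * Matrix.diagonal (bellD s) * (bellVᵀ * bellV) *
        (Matrix.diagonal (bellD s) * bellVᵀ) := by simp only [mul_assoc]
    rw [this, bellV_sq]
    simp only [Matrix.smul_mul, Matrix.mul_smul, smul_smul, mul_one]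
    rw [mul_assoc bellV, ← mul_assoc (Matrix.diagonal _) (Matrix.diagonal _), Matrix.diagonal_mul_diagonal]
    simp only [pow_two]
    norm_num
  rw [h, Matrix.charpoly_mul_comm, Matrix.smul_mul, mul_assoc, bellV_sq, Matrix.mul_smul, smul_smul]
  norm_num [Matrix.charpoly_diagonal]

lemma expand_complex (ρ : Matrix (Fin 2 × Fin 2) (Fin 2 × Fin 2) ℂ) :
    ρ = (1/4 : ℂ) • ∑ i, ∑ j, ((ρ * (pauli i ⊗ₖ pauli j)).trace) • (pauli i ⊗ₖ pauli j) := by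
  have hI : Complex.I ^ 4 = 1 := Complex.I_pow_four
  ext ⟨i, i'⟩ ⟨j, j'⟩
  fin_cases i <;> fin_cases j <;> fin_cases i' <;> fin_cases j' <;>
    simp [pauli, Matrix.mul_apply, Fintype.sum_prod_type, Matrix.trace,
      Fin.sum_univ_four] <;> ring_nf <;> simp only [Complex.I_sq, hI] <;> ring

lemma expand_real (ρ : Matrix (Fin 2 × Fin 2) (Fin 2 × Fin 2) ℂ) (h : ρ.IsHermitian) :
    ρ = (1/4 : ℂ) • ∑ i, ∑ j, (Rmat ρ i j : ℂ) • (pauli i ⊗ₖ pauli j) := by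
  have hr (i j) : (Rmat ρ i j : ℂ) = (ρ * (pauli i ⊗ₖ pauli j)).trace := by
    simp only [Rmat, Matrix.of_apply]
    apply Complex.conj_eq_iff_re.mp
    have := Matrix.trace_conjTranspose (ρ * (pauli i ⊗ₖ pauli j))
    rw [Matrix.conjTranspose_mul, Matrix.conjTranspose_kronecker, pauli_herm_s12, pauli_herm_s12, h.eq,
      Matrix.trace_mul_comm] at this
    exact this.symm
  simp only [hr]
  exact expand_complex ρ

lemma rho_normal_form (ρ : Matrix (Fin 2 × Fin 2) (Fin 2 × Fin 2) ℂ) (h : ρ.IsHermitian)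
    (s : Fin 4 → ℝ) (L1 L2 : Matrix (Fin 4) (Fin 4) ℝ)
    (hR : Rmat ρ = L1 * Matrix.diagonal s * L2ᵀ) :
    ρ = (1/4 : ℂ) • ∑ k, (s k : ℂ) • ((∑ i, (L1 i k : ℂ) • pauli i) ⊗ₖ
      (∑ j, (L2 j k : ℂ) • pauli j)) := by
  conv_lhs => rw [expand_real ρ h]
  have hR' (i j) : Rmat ρ i j = ∑ k, L1 i k * s k * L2 j k := by
    rw [hR, Matrix.mul_apply]
    simp only [Matrix.mul_diagonal, Matrix.transpose_apply]
  congr 1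
  ext ⟨a, b⟩ ⟨c, d⟩
  simp only [Matrix.sum_apply, Matrix.smul_apply, Matrix.kroneckerMap_apply, hR',
    smul_eq_mul, Complex.ofReal_sum,
    Complex.ofReal_mul, Finset.sum_mul, Finset.mul_sum]
  rw [Finset.sum_congr rfl fun i _ => Finset.sum_comm, Finset.sum_comm]
  refine Finset.sum_congr rfl fun k _ => ?_
  rw [Finset.sum_comm]
  refine Finset.sum_congr rfl fun i _ => Finset.sum_congr rfl fun j _ => ?_
  ring

theorem wootters_eigenvalues_eq_lsv_combinations
    (ρ : Matrix (Fin 2 × Fin 2) (Fin 2 × Fin 2) ℂ)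
    (hρ : ρ.PosSemidef) (htr : ρ.trace = 1)
    (s : Fin 4 → ℝ) (h : HasLSV (Rmat ρ) s) :
    (woottersMat ρ).charpoly.roots =
      {(((s 0 + s 1 + s 2 - s 3) / 4 : ℝ) : ℂ) ^ 2,
       (((s 0 + s 1 - s 2 + s 3) / 4 : ℝ) : ℂ) ^ 2,
       (((s 0 - s 1 + s 2 + s 3) / 4 : ℝ) : ℂ) ^ 2,
       (((s 0 - s 1 - s 2 - s 3) / 4 : ℝ) : ℂ) ^ 2} := by
  obtain ⟨-, -, -, L1, L2, h1, h2, hR⟩ := h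
  obtain ⟨A1, B1, d1, e1⟩ := lorentz_lift L1 h1
  obtain ⟨A2, B2, d2, e2⟩ := lorentz_lift L2 h2
  have hρ0 : ρ = (A1 ⊗ₖ A2) * rho0 s * (B1 ⊗ₖ B2) := by
    rw [rho_normal_form ρ hρ.1 s L1 L2 hR]
    simp only [e1, e2, rho0, Matrix.mul_kronecker_mul, Matrix.mul_smul, Matrix.smul_mul,
      Finset.mul_sum, Finset.sum_mul]
  have hflip (A B : Matrix (Fin 2) (Fin 2) ℂ) :
      (pauli 2 ⊗ₖ pauli 2) * (A ⊗ₖ B)ᵀ * (pauli 2 ⊗ₖ pauli 2) = A.adjugate ⊗ₖ B.adjugate := by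
    rw [← Matrix.kroneckerMap_transpose, ← Matrix.mul_kronecker_mul, ← Matrix.mul_kronecker_mul,
      pauli_flip, pauli_flip]
  have hE : (pauli 2 ⊗ₖ pauli 2) * (pauli 2 ⊗ₖ pauli 2) = 1 := by
    rw [← Matrix.mul_kronecker_mul, pauli2_sq, Matrix.one_kronecker_one]
  have hadjA : (A1.adjugate ⊗ₖ A2.adjugate) * (A1 ⊗ₖ A2) = (A1.det * A2.det) • 1 := by
    rw [← Matrix.mul_kronecker_mul, Matrix.adjugate_mul, Matrix.adjugate_mul,
      Matrix.smul_kronecker, Matrix.kronecker_smul, Matrix.one_kronecker_one, smul_smul]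
  have hadjB : (B1 ⊗ₖ B2) * (B1.adjugate ⊗ₖ B2.adjugate) = (B1.det * B2.det) • 1 := by
    rw [← Matrix.mul_kronecker_mul, Matrix.mul_adjugate, Matrix.mul_adjugate,
      Matrix.smul_kronecker, Matrix.kronecker_smul, Matrix.one_kronecker_one, smul_smul]
  have hW : woottersMat ρ = (B1.adjugate ⊗ₖ B2.adjugate) *
      ((A1.det * A2.det) • (rho0 s * rho0 s * (B1 ⊗ₖ B2))) := by
    have hins (E X Y Z : Matrix (Fin 2 × Fin 2) (Fin 2 × Fin 2) ℂ) (hE : E * E = 1) :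
        E * (X * (Y * Z)) * E = (E * X * E) * (E * Y * E) * (E * Z * E) := by
      have hE' (T : Matrix (Fin 2 × Fin 2) (Fin 2 × Fin 2) ℂ) : E * (E * T) = T := by
        rw [← mul_assoc, hE, one_mul]
      simp only [mul_assoc, hE']
    rw [woottersMat, hρ0, Matrix.transpose_mul, Matrix.transpose_mul, hins _ _ _ _ hE, hflip, hflip,
      rho0_flip]
    have : (B1.adjugate ⊗ₖ B2.adjugate) * rho0 s * (A1.adjugate ⊗ₖ A2.adjugate) *
        ((A1 ⊗ₖ A2) * rho0 s * (B1 ⊗ₖ B2)) = (B1.adjugate ⊗ₖ B2.adjugate) * rho0 s *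
        ((A1.adjugate ⊗ₖ A2.adjugate) * (A1 ⊗ₖ A2)) * (rho0 s * (B1 ⊗ₖ B2)) := by
      simp only [mul_assoc]
    rw [this, hadjA]
    simp only [Matrix.mul_smul, Matrix.smul_mul, mul_one, mul_assoc]
  have hc : (woottersMat ρ).charpoly = (rho0 s * rho0 s).charpoly := by
    rw [hW, Matrix.charpoly_mul_comm, Matrix.smul_mul, mul_assoc, hadjB, Matrix.mul_smul, smul_smul,
      show A1.det * A2.det * (B1.det * B2.det) = (A1.det * B1.det) * (A2.det * B2.det) by ring,
      d1, d2]
    simp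
  rw [hc, rho0_sq_charpoly, Finset.prod_eq_multiset_prod]
  have := Polynomial.roots_multiset_prod_X_sub_C
    ((Finset.univ : Finset (Fin 2 × Fin 2)).val.map fun i => bellD s i ^ 2)
  rw [Multiset.map_map] at this
  refine Eq.trans this ?_
  have hu : (Finset.univ : Finset (Fin 2 × Fin 2)).val
      = {(0, 1), (0, 0), (1, 1), (1, 0)} := by decide
  rw [hu]
  simp [bellD]
end
end

section
/- Let ρ be a two-qubit density matrix whose R-matrix has Lorentz singular values s0 ≥ s1 ≥ s2 ≥ |s3|, and let λ1 ≥ λ2 ≥ λ3 ≥ λ4 ≥ 0 be the decreasingly ordered nonnegative square roots of the eigenvalues of (σ2⊗σ2) · ρᵀ · (σ2⊗σ2) · ρ (these eigenvalues are nonnegative reals). Then the Wootters concurrence satisfies max(0, λ1 − λ2 − λ3 − λ4) = max(0, −(s0 − s1 − s2 + s3)/2). -/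
open Matrix Kronecker ComplexOrder

noncomputable section

theorem jac (L K : Matrix (Fin 4) (Fin 4) ℝ) (h : L * K = 1) :
    L.det * (K 0 0 * K 1 1 - K 0 1 * K 1 0) = L 2 2 * L 3 3 - L 2 3 * L 3 2 := by
  have h1 : ∀ i j, L i 0 * K 0 j + L i 1 * K 1 j + L i 2 * K 2 j + L i 3 * K 3 j
      = if i = j then 1 else 0 := by
    intro i j
    rw [← Matrix.one_apply, ← h, Matrix.mul_apply, Fin.sum_univ_four]
  have e : L * !![K 0 0, K 0 1, 0, 0; K 1 0, K 1 1, 0, 0; K 2 0, K 2 1, 1, 0; K 3 0, K 3 1, 0, 1]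
      = !![1, 0, L 0 2, L 0 3; 0, 1, L 1 2, L 1 3; 0, 0, L 2 2, L 2 3; 0, 0, L 3 2, L 3 3] := by
    ext i j
    have a0 := h1 i 0
    have a1 := h1 i 1
    fin_cases i <;> fin_cases j <;>
      simp [Matrix.mul_apply, Fin.sum_univ_four] at a0 a1 ⊢ <;> linarith
  have e2 := congrArg Matrix.det e
  rw [Matrix.det_mul] at e2
  have d1 : (!![K 0 0, K 0 1, 0, 0; K 1 0, K 1 1, 0, 0; K 2 0, K 2 1, 1, 0; K 3 0, K 3 1, 0, 1] :
      Matrix (Fin 4) (Fin 4) ℝ).det = K 0 0 * K 1 1 - K 0 1 * K 1 0 := by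
    simp [Matrix.det_succ_row_zero, Fin.sum_univ_succ, Fin.succAbove]
    try ring
  have d2 : (!![1, 0, L 0 2, L 0 3; 0, 1, L 1 2, L 1 3; 0, 0, L 2 2, L 2 3; 0, 0, L 3 2, L 3 3] :
      Matrix (Fin 4) (Fin 4) ℝ).det = L 2 2 * L 3 3 - L 2 3 * L 3 2 := by
    simp [Matrix.det_succ_row_zero, Fin.sum_univ_succ, Fin.succAbove]
    try ring
  rw [d1, d2] at e2
  exact e2

theorem jac2 (L : Matrix (Fin 4) (Fin 4) ℝ) (hL : LorentzPO L) (e f : Equiv.Perm (Fin 4)) :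
    ((Equiv.Perm.sign e : ℤ) : ℝ) * ((Equiv.Perm.sign f : ℤ) : ℝ) *
      ((η * Lᵀ * η) (f 0) (e 0) * (η * Lᵀ * η) (f 1) (e 1)
        - (η * Lᵀ * η) (f 0) (e 1) * (η * Lᵀ * η) (f 1) (e 0))
      = L (e 2) (f 2) * L (e 3) (f 3) - L (e 2) (f 3) * L (e 3) (f 2) := by
  obtain ⟨h1, h2, -⟩ := hL
  have hη : η * η = 1 := by
    ext i j; fin_cases i <;> fin_cases j <;> simp [η]
  have h3 : (η * Lᵀ * η) * L = 1 := by
    rw [Matrix.mul_assoc, Matrix.mul_assoc, ← Matrix.mul_assoc Lᵀ, h1, hη]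
  have h4 : L * (η * Lᵀ * η) = 1 := mul_eq_one_comm.mp h3
  have := jac (L.submatrix e f) ((η * Lᵀ * η).submatrix f e) (by
    rw [Matrix.submatrix_mul_equiv, h4, Matrix.submatrix_one_equiv])
  have hd : (L.submatrix e f).det = ((Equiv.Perm.sign e : ℤ) : ℝ) * ((Equiv.Perm.sign f : ℤ) : ℝ) := by
    have : L.submatrix e f = (L.submatrix e id).submatrix id f := rfl
    rw [this, Matrix.det_permute', Matrix.det_permute, h2]
    ring
  rw [hd] at this
  exact this

theorem eta_conj (L : Matrix (Fin 4) (Fin 4) ℝ) (i j : Fin 4) :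
    (η * Lᵀ * η) i j = ![1, -1, -1, -1] i * L j i * ![1, -1, -1, -1] j := by
  simp [η]

theorem rel1 (L : Matrix (Fin 4) (Fin 4) ℝ) (hL : LorentzPO L) (i j : Fin 4) :
    L 0 i * L 0 j - L 1 i * L 1 j - L 2 i * L 2 j - L 3 i * L 3 j = η i j := by
  rw [← hL.1]
  simp [η, Matrix.mul_apply, Fin.sum_univ_four]
  ring

theorem rel2 (L : Matrix (Fin 4) (Fin 4) ℝ) (hL : LorentzPO L) (i j : Fin 4) :
    L i 0 * L j 0 - L i 1 * L j 1 - L i 2 * L j 2 - L i 3 * L j 3 = η i j := by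
  obtain ⟨h1, h2, -⟩ := hL
  have hη : η * η = 1 := by
    ext i j; fin_cases i <;> fin_cases j <;> simp [η]
  have h3 : (η * Lᵀ * η) * L = 1 := by
    rw [Matrix.mul_assoc, Matrix.mul_assoc, ← Matrix.mul_assoc Lᵀ, h1, hη]
  have h4 : L * (η * Lᵀ * η) = 1 := mul_eq_one_comm.mp h3
  have h5 : L * η * Lᵀ = η := by
    calc L * η * Lᵀ = L * (η * Lᵀ * η) * η := by
          simp only [Matrix.mul_assoc, hη, Matrix.mul_one]
      _ = η := by rw [h4, Matrix.one_mul]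
  rw [← h5]
  simp [η, Matrix.mul_apply, Fin.sum_univ_four]
  ring

/-- The (twice) Choi matrix of the linear map on 2×2 matrices attached to `L`. -/
def choi (L : Matrix (Fin 4) (Fin 4) ℝ) (x y : Fin 2 × Fin 2) : ℂ :=
  ∑ i, ∑ j, (L i j : ℂ) * pauli i x.1 y.1 * pauli j y.2 x.2

set_option maxHeartbeats 4000000 in
open Equiv in
theorem minors (L : Matrix (Fin 4) (Fin 4) ℝ) (hL : LorentzPO L) :
    ∀ x y k, choi L x y * choi L k k = choi L x k * choi L k y := by
  have h := jac2 L hL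
  simp only [eta_conj] at h
  have a1 := h 1 1
  have a2 := h 1 (swap 1 2)
  have a3 := h 1 (swap 1 3)
  have a4 := h 1 (swap 0 2 * swap 1 3)
  have a5 := h 1 (swap 0 2)
  have a6 := h 1 (swap 0 3)
  have b1 := h (swap 1 2) 1
  have b2 := h (swap 1 2) (swap 1 2)
  have b3 := h (swap 1 2) (swap 1 3)
  have b4 := h (swap 1 2) (swap 0 2 * swap 1 3)
  have b5 := h (swap 1 2) (swap 0 2)
  have b6 := h (swap 1 2) (swap 0 3)
  have c1 := h (swap 1 3) 1
  have c2 := h (swap 1 3) (swap 1 2)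
  have c3 := h (swap 1 3) (swap 1 3)
  have c4 := h (swap 1 3) (swap 0 2 * swap 1 3)
  have c5 := h (swap 1 3) (swap 0 2)
  have c6 := h (swap 1 3) (swap 0 3)
  simp [swap_apply_def] at a1 a2 a3 a4 a5 a6 b1 b2 b3 b4 b5 b6 c1 c2 c3 c4 c5 c6
  clear h
  have r1 := rel1 L hL
  have r2 := rel2 L hL
  have p00 := r1 0 0
  have p01 := r1 0 1
  have p02 := r1 0 2
  have p03 := r1 0 3
  have p11 := r1 1 1
  have p12 := r1 1 2
  have p13 := r1 1 3
  have p22 := r1 2 2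
  have p23 := r1 2 3
  have p33 := r1 3 3
  have q00 := r2 0 0
  have q01 := r2 0 1
  have q02 := r2 0 2
  have q03 := r2 0 3
  have q11 := r2 1 1
  have q12 := r2 1 2
  have q13 := r2 1 3
  have q22 := r2 2 2
  have q23 := r2 2 3
  have q33 := r2 3 3
  simp [η] at p00 p01 p02 p03 p11 p12 p13 p22 p23 p33 q00 q01 q02 q03 q11 q12 q13 q22 q23 q33
  clear r1 r2
  clear hL
  intro x y k
  by_cases h1 : x = k
  · subst h1; ring
  by_cases h2 : y = k
  · subst h2; ring
  obtain ⟨x1, x2⟩ := x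
  obtain ⟨y1, y2⟩ := y
  obtain ⟨k1, k2⟩ := k
  fin_cases x1 <;> fin_cases x2 <;> fin_cases y1 <;> fin_cases y2 <;> fin_cases k1 <;>
    fin_cases k2 <;>
    first
    | exact absurd rfl h1
    | exact absurd rfl h2
    | (refine Complex.ext ?_ ?_ <;> simp [choi, pauli, Fin.sum_univ_four] <;> linarith)
theorem pauli_herm_s13 (i : Fin 4) (a b : Fin 2) : star (pauli i a b) = pauli i b a := by
  fin_cases i <;> fin_cases a <;> fin_cases b <;> simp [pauli]

theorem choi_herm (L : Matrix (Fin 4) (Fin 4) ℝ) (x y : Fin 2 × Fin 2) :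
    star (choi L x y) = choi L y x := by
  simp only [choi, star_sum, star_mul', pauli_herm_s13]
  simp

theorem choi_trace (L : Matrix (Fin 4) (Fin 4) ℝ) :
    choi L (0,0) (0,0) + choi L (0,1) (0,1) + choi L (1,0) (1,0) + choi L (1,1) (1,1)
      = 4 * (L 0 0 : ℂ) := by
  simp [choi, pauli, Fin.sum_univ_four]
  ring

theorem choi_apply (L : Matrix (Fin 4) (Fin 4) ℝ) (a c : Fin 2) (m : Fin 4) :
    ∑ b, ∑ d, choi L (a, b) (c, d) * pauli m b d = 2 * ∑ i, (L i m : ℂ) * pauli i a c := by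
  have hp : ∀ j, ∑ b, ∑ d, pauli j d b * pauli m b d = if j = m then 2 else 0 := by
    intro j
    fin_cases j <;> fin_cases m <;> simp [pauli, Fin.sum_univ_two] <;> norm_num
  calc ∑ b, ∑ d, choi L (a, b) (c, d) * pauli m b d
      = ∑ i, ∑ j, (L i j : ℂ) * pauli i a c * ∑ b, ∑ d, pauli j d b * pauli m b d := by
        simp only [choi, Fin.sum_univ_two, Fin.sum_univ_four]
        ring
    _ = _ := by
        simp only [hp]
        rw [Finset.mul_sum]
        refine Finset.sum_congr rfl fun i _ => ?_
        simp
        ring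

theorem pauli_det (t : Fin 4 → ℝ) :
    (∑ i, (t i : ℂ) • pauli i).det = ((t 0 * t 0 - t 1 * t 1 - t 2 * t 2 - t 3 * t 3 : ℝ) : ℂ) := by
  rw [Matrix.det_fin_two]
  simp [pauli, Fin.sum_univ_four]
  linear_combination (t 2 : ℂ)^2 * Complex.I_sq

theorem spinor_lift (L : Matrix (Fin 4) (Fin 4) ℝ) (hL : LorentzPO L) :
    ∃ A : Matrix (Fin 2) (Fin 2) ℂ, A.det * star A.det = 1 ∧
      ∀ m, A * pauli m * Aᴴ = ∑ i, (L i m : ℂ) • pauli i := by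
  have hre : ∀ x, (choi L x x) = (((choi L x x).re : ℝ) : ℂ) := by
    intro x
    have := choi_herm L x x
    exact (Complex.conj_eq_iff_re.mp this).symm
  obtain ⟨k, hk⟩ : ∃ k, 0 < (choi L k k).re := by
    by_contra hcon
    push Not at hcon
    have := congrArg Complex.re (choi_trace L)
    simp only [Complex.add_re] at this
    have h4 : (4 * (L 0 0 : ℂ)).re = 4 * L 0 0 := by simp
    rw [h4] at this
    linarith [hcon (0,0), hcon (0,1), hcon (1,0), hcon (1,1), hL.2.2]
  set r : ℝ := (choi L k k).re with hr
  let c : ℂ := ((Real.sqrt (2 * r) : ℝ) : ℂ)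
  have hc : c * c = 2 * choi L k k := by
    rw [hre k, ← hr]
    simp only [c]
    rw [← Complex.ofReal_mul, Real.mul_self_sqrt (by linarith)]
    push_cast; rfl
  have hk0 : choi L k k ≠ 0 := by
    rw [hre k, ← hr]; exact_mod_cast hk.ne'
  have hc0 : c ≠ 0 := by
    intro h; rw [h] at hc; apply hk0; linear_combination (-1/2) * hc
  have hcs : star c = c := Complex.conj_ofReal _
  have hch : ∀ x y, choi L x y = 2 * ((choi L x k / c) * star (choi L y k / c)) := by
    intro x y
    rw [star_div₀, hcs, choi_herm]
    field_simp
    have := minors L hL x y k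
    rw [pow_two, hc]
    linear_combination 2 * this
  let A : Matrix (Fin 2) (Fin 2) ℂ := Matrix.of fun a b => choi L (a, b) k / c
  have hA : ∀ m, A * pauli m * Aᴴ = ∑ i, (L i m : ℂ) • pauli i := by
    intro m
    ext a e
    have h1 := choi_apply L a e m
    have h2 : (A * pauli m * Aᴴ) a e = (1/2) * ∑ b, ∑ d, choi L (a, b) (e, d) * pauli m b d := by
      simp only [hch (a, _) (e, _)]
      simp only [Matrix.mul_apply, Fin.sum_univ_two, Matrix.conjTranspose_apply, A, Matrix.of_apply]
      ring
    rw [h2, h1]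
    simp [Matrix.sum_apply]
  refine ⟨A, ?_, hA⟩
  have h0 := congrArg Matrix.det (hA 0)
  rw [pauli_det (fun i => L i 0), rel1 L hL] at h0
  simpa [Matrix.det_mul, Matrix.det_conjTranspose, pauli, η] using h0
theorem pauli_conjT (i : Fin 4) : (pauli i)ᴴ = pauli i := by
  ext a b
  rw [Matrix.conjTranspose_apply, pauli_herm_s13]

theorem pauli_expand_s13 (ρ : Matrix (Fin 2 × Fin 2) (Fin 2 × Fin 2) ℂ) :
    ρ = ∑ i, ∑ j, ((1/4 : ℂ) * (ρ * (pauli i ⊗ₖ pauli j)).trace) • (pauli i ⊗ₖ pauli j) := by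
  have hI := Complex.I_sq
  ext ⟨a, b⟩ ⟨c, d⟩
  fin_cases a <;> fin_cases b <;> fin_cases c <;> fin_cases d <;>
    simp [pauli, Fin.sum_univ_four, Matrix.trace, Matrix.mul_apply, Fintype.sum_prod_type,
      Fin.sum_univ_two, Matrix.add_apply] <;>
    ring_nf <;> simp [Complex.I_sq] <;> ring

theorem Rmat_expand (ρ : Matrix (Fin 2 × Fin 2) (Fin 2 × Fin 2) ℂ) (h : ρ.IsHermitian) :
    ρ = ∑ i, ∑ j, ((1/4 : ℂ) * (Rmat ρ i j : ℂ)) • (pauli i ⊗ₖ pauli j) := by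
  have hr : ∀ i j, (Rmat ρ i j : ℂ) = (ρ * (pauli i ⊗ₖ pauli j)).trace := by
    intro i j
    simp only [Rmat, Matrix.of_apply]
    refine Complex.conj_eq_iff_re.mp ?_
    change star _ = _
    rw [← Matrix.trace_conjTranspose, Matrix.conjTranspose_mul, Matrix.conjTranspose_kronecker,
      pauli_conjT, pauli_conjT, h.eq, Matrix.trace_mul_comm]
  simp only [hr]
  exact pauli_expand_s13 ρ

/-- The Bell-diagonal matrix with `R`-matrix `diag s`. -/
def bell (s : Fin 4 → ℝ) : Matrix (Fin 2 × Fin 2) (Fin 2 × Fin 2) ℂ :=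
  ∑ k, ((1/4 : ℂ) * (s k : ℂ)) • (pauli k ⊗ₖ pauli k)

theorem normal_form (ρ : Matrix (Fin 2 × Fin 2) (Fin 2 × Fin 2) ℂ) (h : ρ.IsHermitian)
    (s : Fin 4 → ℝ) (L1 L2 : Matrix (Fin 4) (Fin 4) ℝ)
    (hR : Rmat ρ = L1 * Matrix.diagonal s * L2ᵀ) (A B : Matrix (Fin 2) (Fin 2) ℂ)
    (hA : ∀ m, A * pauli m * Aᴴ = ∑ i, (L1 i m : ℂ) • pauli i)
    (hB : ∀ m, B * pauli m * Bᴴ = ∑ i, (L2 i m : ℂ) • pauli i) :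
    ρ = (A ⊗ₖ B) * bell s * (A ⊗ₖ B)ᴴ := by
  have h1 : (A ⊗ₖ B) * bell s * (A ⊗ₖ B)ᴴ
      = ∑ k, ((1/4 : ℂ) * (s k : ℂ)) • ((∑ i, (L1 i k : ℂ) • pauli i) ⊗ₖ (∑ i, (L2 i k : ℂ) • pauli i)) := by
    simp only [bell, Matrix.mul_sum, Matrix.sum_mul, Matrix.mul_smul, Matrix.smul_mul,
      Matrix.conjTranspose_kronecker, ← Matrix.mul_kronecker_mul, hA, hB]
  rw [h1]
  conv_lhs => rw [Rmat_expand ρ h]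
  have h2 : ∀ i j, (Rmat ρ i j : ℂ) = ∑ k, (L1 i k : ℂ) * s k * L2 j k := by
    intro i j
    rw [hR]
    simp [Matrix.mul_apply, Matrix.diagonal_apply]
  ext ⟨a, b⟩ ⟨c, d⟩
  simp only [h2, Matrix.sum_apply, Matrix.smul_apply, Matrix.kroneckerMap_apply, smul_eq_mul,
    Finset.mul_sum, Finset.sum_mul]
  rw [Finset.sum_comm' (t' := Finset.univ) (s' := fun _ => Finset.univ) (by simp)]
  rw [Finset.sum_comm]
  simp only [Fin.sum_univ_four]
  ring

theorem sigma_conj (A : Matrix (Fin 2) (Fin 2) ℂ) : Aᵀ * pauli 2 * A = A.det • pauli 2 := by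
  ext a b
  fin_cases a <;> fin_cases b <;>
    simp [pauli, Matrix.mul_apply, Fin.sum_univ_two, Matrix.det_fin_two] <;> ring

theorem wootters_charpoly (A B : Matrix (Fin 2) (Fin 2) ℂ)
    (hA : A.det * star A.det = 1) (hB : B.det * star B.det = 1)
    (τ : Matrix (Fin 2 × Fin 2) (Fin 2 × Fin 2) ℂ) :
    (woottersMat ((A ⊗ₖ B) * τ * (A ⊗ₖ B)ᴴ)).charpoly = (woottersMat τ).charpoly := by
  set G := A ⊗ₖ B with hG
  set Y := pauli 2 ⊗ₖ pauli 2 with hY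
  have e1 : Gᵀ * Y * G = (A.det * B.det) • Y := by
    have : Gᵀ = Aᵀ ⊗ₖ Bᵀ := (Matrix.kroneckerMap_transpose _ _ _).symm
    rw [this, hG, hY, ← Matrix.mul_kronecker_mul, ← Matrix.mul_kronecker_mul, sigma_conj, sigma_conj,
      Matrix.smul_kronecker, Matrix.kronecker_smul, smul_smul]
  have hYh : Yᴴ = Y := by
    rw [hY, Matrix.conjTranspose_kronecker, pauli_conjT]
  have e2 : Gᴴ * Y * Gᴴᵀ = star (A.det * B.det) • Y := by
    have := congrArg Matrix.conjTranspose e1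
    rw [Matrix.conjTranspose_mul, Matrix.conjTranspose_mul, Matrix.conjTranspose_smul, hYh] at this
    rw [← this, Matrix.mul_assoc]
    rfl
  have e3 : woottersMat (G * τ * Gᴴ) = (Y * Gᴴᵀ * τᵀ * (Gᵀ * Y * G) * τ) * Gᴴ := by
    simp only [woottersMat, ← hY, Matrix.transpose_mul, Matrix.mul_assoc]
  rw [e3, Matrix.charpoly_mul_comm, e1]
  have e4 : Gᴴ * (Y * Gᴴᵀ * τᵀ * ((A.det * B.det) • Y) * τ)
      = (Gᴴ * Y * Gᴴᵀ) * τᵀ * ((A.det * B.det) • Y) * τ := by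
    simp only [Matrix.mul_assoc]
  rw [e4, e2]
  congr 1
  simp only [woottersMat, ← hY, Matrix.smul_mul, Matrix.mul_smul, smul_smul]
  have : A.det * B.det * star (A.det * B.det) = 1 := by
    rw [star_mul']
    linear_combination (A.det * star A.det) * hB + hA
  rw [mul_comm] at this
  first | rw [this, one_smul] | rw [mul_comm, this, one_smul]

/-- Bell basis change. -/
def bellP : Matrix (Fin 2 × Fin 2) (Fin 2 × Fin 2) ℂ :=
  Matrix.of fun x y =>
    if x.1 = x.2 then (if y.1 = 0 then (if y.2 = 0 then 1 else if x.1 = 0 then 1 else -1) else 0)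
    else (if y.1 = 1 then (if y.2 = 0 then 1 else if x.1 = 0 then 1 else -1) else 0)

def bellMu (s : Fin 4 → ℝ) (y : Fin 2 × Fin 2) : ℝ :=
  if y.1 = 0 then (if y.2 = 0 then (s 0 + s 1 - s 2 + s 3) / 4 else (s 0 - s 1 + s 2 + s 3) / 4)
  else (if y.2 = 0 then (s 0 + s 1 + s 2 - s 3) / 4 else (s 0 - s 1 - s 2 - s 3) / 4)

theorem bellP_mul : bellP * ((1/2 : ℂ) • bellPᵀ) = 1 := by
  ext ⟨a, b⟩ ⟨c, d⟩
  fin_cases a <;> fin_cases b <;> fin_cases c <;> fin_cases d <;>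
    simp [bellP, Matrix.mul_apply, Fintype.sum_prod_type, Fin.sum_univ_two] <;> norm_num

theorem bell_mul_P (s : Fin 4 → ℝ) :
    bell s * bellP = bellP * Matrix.diagonal (fun y => (bellMu s y : ℂ)) := by
  ext ⟨a, b⟩ ⟨c, d⟩
  fin_cases a <;> fin_cases b <;> fin_cases c <;> fin_cases d <;>
    simp [bell, bellP, bellMu, pauli, Matrix.mul_apply, Fintype.sum_prod_type, Fin.sum_univ_two,
      Fin.sum_univ_four, Matrix.add_apply] <;> ring

theorem bell_eq (s : Fin 4 → ℝ) :
    bell s = bellP * Matrix.diagonal (fun y => (bellMu s y : ℂ)) * ((1/2 : ℂ) • bellPᵀ) := by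
  rw [← bell_mul_P, Matrix.mul_assoc, bellP_mul, Matrix.mul_one]

theorem bell_tilde (s : Fin 4 → ℝ) :
    (pauli 2 ⊗ₖ pauli 2) * (bell s)ᵀ * (pauli 2 ⊗ₖ pauli 2) = bell s := by
  ext ⟨a, b⟩ ⟨c, d⟩
  fin_cases a <;> fin_cases b <;> fin_cases c <;> fin_cases d <;>
    simp [bell, pauli, Matrix.mul_apply, Fintype.sum_prod_type, Fin.sum_univ_two,
      Fin.sum_univ_four, Matrix.add_apply]

theorem bell_wootters (s : Fin 4 → ℝ) :
    (woottersMat (bell s)).charpoly.roots =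
      {((bellMu s (1,0) : ℝ) : ℂ) ^ 2, ((bellMu s (0,0) : ℝ) : ℂ) ^ 2,
       ((bellMu s (0,1) : ℝ) : ℂ) ^ 2, ((bellMu s (1,1) : ℝ) : ℂ) ^ 2} := by
  have h1 : woottersMat (bell s) = bell s * bell s := by
    rw [woottersMat, bell_tilde]
  have h2 : ((1/2 : ℂ) • bellPᵀ) * bellP = 1 := mul_eq_one_comm.mp bellP_mul
  have h3 : (woottersMat (bell s)).charpoly
      = (Matrix.diagonal (fun y => ((bellMu s y : ℝ) : ℂ) ^ 2)).charpoly := by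
    have h4 : bell s * bell s = bellP * (Matrix.diagonal (fun y => ((bellMu s y : ℝ) : ℂ) ^ 2)
        * ((1/2 : ℂ) • bellPᵀ)) := by
      conv_lhs => rw [bell_eq s, ← Matrix.mul_assoc, ← bell_eq s, ← Matrix.mul_assoc, bell_mul_P]
      rw [Matrix.mul_assoc bellP, Matrix.diagonal_mul_diagonal, Matrix.mul_assoc]
      simp only [pow_two]
    rw [h1, h4, Matrix.charpoly_mul_comm, Matrix.mul_assoc, h2, Matrix.mul_one]
  rw [h3, Matrix.charpoly_diagonal]
  rw [← Polynomial.roots_multiset_prod_X_sub_C ({((bellMu s (1,0) : ℝ) : ℂ) ^ 2,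
    ((bellMu s (0,0) : ℝ) : ℂ) ^ 2, ((bellMu s (0,1) : ℝ) : ℂ) ^ 2,
    ((bellMu s (1,1) : ℝ) : ℂ) ^ 2} : Multiset ℂ)]
  congr 1
  simp only [Fintype.prod_prod_type, Fin.prod_univ_two, Multiset.insert_eq_cons, Multiset.map_cons,
    Multiset.prod_cons, Multiset.map_singleton, Multiset.prod_singleton]
  ring

theorem bell_psd (s : Fin 4 → ℝ) (h : (bell s).PosSemidef) : 0 ≤ s 0 - s 1 - s 2 - s 3 := by
  have h1 := h.dotProduct_mulVec_nonneg (fun y => bellP y (1, 1))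
  have h2 : star (fun y => bellP y (1, 1)) ⬝ᵥ (bell s *ᵥ (fun y => bellP y (1, 1)))
      = (((s 0 - s 1 - s 2 - s 3) / 2 : ℝ) : ℂ) := by
    simp [bell, bellP, pauli, dotProduct, Matrix.mulVec, Fintype.sum_prod_type,
      Fin.sum_univ_two, Fin.sum_univ_four, Matrix.add_apply]
    ring
  rw [h2] at h1
  have h3 : 0 ≤ (s 0 - s 1 - s 2 - s 3) / 2 := by exact_mod_cast h1
  linarith

theorem four_sorted (a b c d a' b' c' d' : ℝ)
    (h : ({(a : ℂ) ^ 2, (b : ℂ) ^ 2, (c : ℂ) ^ 2, (d : ℂ) ^ 2} : Multiset ℂ)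
      = {(a' : ℂ) ^ 2, (b' : ℂ) ^ 2, (c' : ℂ) ^ 2, (d' : ℂ) ^ 2})
    (h1 : b ≤ a) (h2 : c ≤ b) (h3 : d ≤ c) (h4 : 0 ≤ d)
    (h1' : b' ≤ a') (h2' : c' ≤ b') (h3' : d' ≤ c') (h4' : 0 ≤ d') :
    a = a' ∧ b = b' ∧ c = c' ∧ d = d' := by
  have hs : ∀ x : ℝ, 0 ≤ x → Real.sqrt (((x : ℂ) ^ 2).re) = x := by
    intro x hx
    rw [← Complex.ofReal_pow, Complex.ofReal_re, Real.sqrt_sq hx]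
  have hm := congrArg (Multiset.map (fun z : ℂ => Real.sqrt z.re)) h
  simp only [Multiset.insert_eq_cons, Multiset.map_cons, Multiset.map_singleton] at hm
  rw [hs a (by linarith), hs b (by linarith), hs c (by linarith), hs d (by linarith),
    hs a' (by linarith), hs b' (by linarith), hs c' (by linarith), hs d' (by linarith)] at hm
  have hp : List.Perm [a, b, c, d] [a', b', c', d'] := Multiset.coe_eq_coe.mp hm
  have he : [a, b, c, d] = [a', b', c', d'] := by
    refine List.Perm.eq_of_pairwise (le := fun x y : ℝ => y ≤ x) ?_ ?_ ?_ hp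
    · intro x y _ _ h5 h6
      exact le_antisymm h6 h5
    · simp
      refine ⟨⟨?_, ?_, ?_⟩, ⟨?_, ?_⟩, ?_⟩ <;> linarith
    · simp
      refine ⟨⟨?_, ?_, ?_⟩, ⟨?_, ?_⟩, ?_⟩ <;> linarith
  simpa using he

theorem concurrence_eq_lsv_formula
    (ρ : Matrix (Fin 2 × Fin 2) (Fin 2 × Fin 2) ℂ)
    (hρ : ρ.PosSemidef) (htr : ρ.trace = 1)
    (s : Fin 4 → ℝ) (h : HasLSV (Rmat ρ) s)
    (lam : Fin 4 → ℝ)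
    (hord : lam 1 ≤ lam 0 ∧ lam 2 ≤ lam 1 ∧ lam 3 ≤ lam 2 ∧ 0 ≤ lam 3)
    (heig : (woottersMat ρ).charpoly.roots =
      {((lam 0 : ℂ)) ^ 2, ((lam 1 : ℂ)) ^ 2, ((lam 2 : ℂ)) ^ 2, ((lam 3 : ℂ)) ^ 2}) :
    max 0 (lam 0 - lam 1 - lam 2 - lam 3) =
      max 0 (-(s 0 - s 1 - s 2 + s 3) / 2) := by
  obtain ⟨h10, h21, h32, L1, L2, hL1, hL2, hR⟩ := h
  obtain ⟨A, hA, hA'⟩ := spinor_lift L1 hL1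
  obtain ⟨B, hB, hB'⟩ := spinor_lift L2 hL2
  have hnf := normal_form ρ hρ.isHermitian s L1 L2 hR A B hA' hB'
  have hroots := bell_wootters s
  rw [← wootters_charpoly A B hA hB, ← hnf, heig] at hroots
  have hdA : A.det ≠ 0 := by
    intro h0; rw [h0] at hA; simp at hA
  have hdB : B.det ≠ 0 := by
    intro h0; rw [h0] at hB; simp at hB
  have hU : IsUnit (A ⊗ₖ B) := by
    rw [Matrix.isUnit_iff_isUnit_det, Matrix.det_kronecker, isUnit_iff_ne_zero]
    exact mul_ne_zero (pow_ne_zero _ hdA) (pow_ne_zero _ hdB)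
  have hpsd : (bell s).PosSemidef := by
    rw [hnf] at hρ
    exact (Matrix.IsUnit.posSemidef_star_right_conjugate_iff hU).mp hρ
  have hmu := bell_psd s hpsd
  obtain ⟨ha, hb⟩ := abs_le.mp h32
  have hfin := four_sorted _ _ _ _ _ _ _ _ hroots hord.1 hord.2.1 hord.2.2.1 hord.2.2.2
    (by simp [bellMu]; linarith) (by simp [bellMu]; linarith) (by simp [bellMu]; linarith)
    (by simp [bellMu]; linarith)
  obtain ⟨e0, e1, e2, e3⟩ := hfin
  rw [e0, e1, e2, e3]
  congr 1
  simp [bellMu]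
  ring
end
end
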